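/- For fixed m and r, the four families of operators pairwise commute: for all integers k₁, k₂, k₃, k₄ ≥ 0, any two of the operators H_{m,r}^{(k₁)}, Ĥ_{m,r}^{(k₂)}, D_{m,r}^{(k₃)}, D̂_{m,r}^{(k₄)} commute, i.e. for every function F : ℂ^m × ℂ^r → ℂ and every point (x, y) that is admissible for the corresponding identity (every bracket value occurring in a denominator of any coefficient of either iterated sum is nonzero), applying the two operators to F in either order gives the same value at (x, y). -/

import Mathlib

open Finset

/-- Shifted factorial `[x; a]_k` for `k ∈ ℤ`:
`[x; a]_k = [x][x+a]⋯[x+(k-1)a]` for `k ≥ 0` and `[x; a]_{-k} = 1/[x-ka; a]_k`. -/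
noncomputable def sfac (br : ℂ → ℂ) (a x : ℂ) (k : ℤ) : ℂ :=
  if 0 ≤ k then ∏ i ∈ Finset.range k.toNat, br (x + (i : ℂ) * a)
  else (∏ i ∈ Finset.range (-k).toNat, br (x + ((k : ℂ) + (i : ℂ)) * a))⁻¹

/-- The coefficient `C_{μ,I}(x; y; a, b)`. -/
noncomputable def Coef (br : ℂ → ℂ) (a b : ℂ) {m r : ℕ} (μ : Fin m → ℕ)
    (I : Finset (Fin r)) (x : Fin m → ℂ) (y : Fin r → ℂ) : ℂ :=
  (-1 : ℂ) ^ I.card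
    * (∏ i : Fin m, ∏ j : Fin m,
        if i < j then br (x i - x j + ((μ i : ℂ) - (μ j : ℂ)) * a) / br (x i - x j) else 1)
    * (∏ i ∈ I, ∏ j ∈ Iᶜ, br (y i - y j - a) / br (y i - y j))
    * (∏ i : Fin m, ∏ j : Fin m,
        sfac br a (x i - x j + b) (μ i : ℤ) / sfac br a (x i - x j + a) (μ i : ℤ))
    * ∏ i : Fin m,
        ((∏ j ∈ I, br (x i - y j - b) / br (x i - y j + (μ i : ℂ) * a))
          * ∏ j ∈ Iᶜ, br (x i - y j - a) / br (x i - y j + ((μ i : ℂ) - 1) * a))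

/-- Index set of the sums: pairs `(μ, I)` with `μ ∈ ℤ_{≥0}^m`, `I ⊆ {1,…,r}`, `|μ|+|I| = k`. -/
def idxSet (m r k : ℕ) : Finset ((Fin m → ℕ) × Finset (Fin r)) :=
  ((Fintype.piFinset fun _ : Fin m => Finset.range (k + 1)) ×ˢ
      (Finset.univ : Finset (Finset (Fin r)))).filter
    fun p => (∑ i, p.1 i) + p.2.card = k

def xshift (c : ℂ) {m : ℕ} (μ : Fin m → ℕ) (x : Fin m → ℂ) : Fin m → ℂ :=
  fun i => x i + c * (μ i : ℂ)

def xshiftI (c : ℂ) {m : ℕ} (I : Finset (Fin m)) (x : Fin m → ℂ) : Fin m → ℂ :=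
  fun i => x i + c * (if i ∈ I then 1 else 0)

def yshift (c : ℂ) {r : ℕ} (I : Finset (Fin r)) (y : Fin r → ℂ) : Fin r → ℂ :=
  fun j => y j - c * (if j ∈ I then 1 else 0)

def yshiftMu (c : ℂ) {r : ℕ} (μ : Fin r → ℕ) (y : Fin r → ℂ) : Fin r → ℂ :=
  fun j => y j - c * (μ j : ℂ)

/-- The deformed elliptic Ruijsenaars operator `H_{m,r}^{(k)}`. -/
noncomputable def Hop (br : ℂ → ℂ) (δ κ : ℂ) (m r k : ℕ)
    (F : (Fin m → ℂ) → (Fin r → ℂ) → ℂ) (x : Fin m → ℂ) (y : Fin r → ℂ) : ℂ :=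
  ∑ p ∈ idxSet m r k, Coef br δ κ p.1 p.2 x y * F (xshift δ p.1 x) (yshift κ p.2 y)

/-- The operator `D_{m,r}^{(k)}`. -/
noncomputable def Dop (br : ℂ → ℂ) (δ κ : ℂ) (m r k : ℕ)
    (F : (Fin m → ℂ) → (Fin r → ℂ) → ℂ) (x : Fin m → ℂ) (y : Fin r → ℂ) : ℂ :=
  ∑ p ∈ idxSet r m k, Coef br (-κ) (-δ) p.1 p.2 y x * F (xshiftI δ p.2 x) (yshiftMu κ p.1 y)

/-- The operator `Ĥ_{m,r}^{(k)}`. -/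
noncomputable def Hhat (br : ℂ → ℂ) (δ κ : ℂ) (m r k : ℕ)
    (F : (Fin m → ℂ) → (Fin r → ℂ) → ℂ) (x : Fin m → ℂ) (y : Fin r → ℂ) : ℂ :=
  ∑ p ∈ idxSet m r k,
    Coef br (-δ) (-κ) p.1 p.2 (fun i => x i - δ) (fun j => y j + κ)
      * F (xshift (-δ) p.1 x) (yshift (-κ) p.2 y)

/-- The operator `D̂_{m,r}^{(k)}`. -/
noncomputable def Dhat (br : ℂ → ℂ) (δ κ : ℂ) (m r k : ℕ)
    (F : (Fin m → ℂ) → (Fin r → ℂ) → ℂ) (x : Fin m → ℂ) (y : Fin r → ℂ) : ℂ :=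
  ∑ p ∈ idxSet r m k,
    Coef br κ δ p.1 p.2 (fun j => y j + κ) (fun i => x i - δ)
      * F (xshiftI (-δ) p.2 x) (yshiftMu (-κ) p.1 y)

/-- Nonvanishing of all bracket values occurring in denominators of `C_{μ,I}(x; y; a, b)`. -/
def CDenomNZ (br : ℂ → ℂ) (a : ℂ) {m r : ℕ} (μ : Fin m → ℕ)
    (I : Finset (Fin r)) (x : Fin m → ℂ) (y : Fin r → ℂ) : Prop :=
  (∀ i j : Fin m, i < j → br (x i - x j) ≠ 0)
    ∧ (∀ i ∈ I, ∀ j ∈ Iᶜ, br (y i - y j) ≠ 0)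
    ∧ (∀ i j : Fin m, sfac br a (x i - x j + a) (μ i : ℤ) ≠ 0)
    ∧ (∀ i : Fin m, ∀ j ∈ I, br (x i - y j + (μ i : ℂ) * a) ≠ 0)
    ∧ (∀ i : Fin m, ∀ j ∈ Iᶜ, br (x i - y j + ((μ i : ℂ) - 1) * a) ≠ 0)

/-- The four families `H, Ĥ, D, D̂` of operators, indexed by `Fin 4`. -/
noncomputable def OpFam (br : ℂ → ℂ) (δ κ : ℂ) (m r : ℕ) (f : Fin 4) (k : ℕ)
    (F : (Fin m → ℂ) → (Fin r → ℂ) → ℂ) : (Fin m → ℂ) → (Fin r → ℂ) → ℂ :=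
  if f = 0 then Hop br δ κ m r k F
  else if f = 1 then Hhat br δ κ m r k F
  else if f = 2 then Dop br δ κ m r k F
  else Dhat br δ κ m r k F

/-- Admissibility of a point for one application of an operator of family `f`
and order `k`: every bracket value occurring in a denominator of one of
its coefficients is nonzero. -/
def FamAdm (br : ℂ → ℂ) (δ κ : ℂ) (m r : ℕ) (f : Fin 4) (k : ℕ)
    (x : Fin m → ℂ) (y : Fin r → ℂ) : Prop :=
  if f = 0 then ∀ p ∈ idxSet m r k, CDenomNZ br δ p.1 p.2 x y
  else if f = 1 then ∀ p ∈ idxSet m r k,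
    CDenomNZ br (-δ) p.1 p.2 (fun i => x i - δ) (fun j => y j + κ)
  else if f = 2 then ∀ p ∈ idxSet r m k, CDenomNZ br (-κ) p.1 p.2 y x
  else ∀ p ∈ idxSet r m k,
    CDenomNZ br κ p.1 p.2 (fun j => y j + κ) (fun i => x i - δ)

/-- The set of shifted points produced by one application of an operator of
family `f` and order `k` at the point `(x, y)`. -/
def FamShifts (δ κ : ℂ) (m r : ℕ) (f : Fin 4) (k : ℕ)
    (x : Fin m → ℂ) (y : Fin r → ℂ) : Set ((Fin m → ℂ) × (Fin r → ℂ)) :=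
  if f = 0 then {q | ∃ p ∈ idxSet m r k, q = (xshift δ p.1 x, yshift κ p.2 y)}
  else if f = 1 then {q | ∃ p ∈ idxSet m r k, q = (xshift (-δ) p.1 x, yshift (-κ) p.2 y)}
  else if f = 2 then {q | ∃ p ∈ idxSet r m k, q = (xshiftI δ p.2 x, yshiftMu κ p.1 y)}
  else {q | ∃ p ∈ idxSet r m k, q = (xshiftI (-δ) p.2 x, yshiftMu (-κ) p.1 y)}

section
open Filter Topology

/-- The standing assumptions on the bracket: an odd entire function, not identically zero,
satisfying the three-term Riemann relation. -/
structure IsBracket (br : ℂ → ℂ) : Prop where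
  odd : ∀ z : ℂ, br (-z) = -br z
  entire : Differentiable ℂ br
  ne_zero : br ≠ 0
  riemann : ∀ a b c d : ℂ,
      br (a + b) * br (a - b) * br (c + d) * br (c - d)
        + br (a + d) * br (a - d) * br (b + c) * br (b - c)
        = br (a + c) * br (a - c) * br (b + d) * br (b - d)

namespace IsBracket

variable {br : ℂ → ℂ}

theorem map_zero (hb : IsBracket br) : br 0 = 0 := by
  have := hb.odd 0
  rw [neg_zero] at this
  linear_combination this / 2

theorem swap (hb : IsBracket br) (a b : ℂ) : br (a - b) = -br (b - a) := by
  rw [← hb.odd, neg_sub]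

/-- The three-term relation in the form of a `2 × 2` minor. -/
theorem minor (hb : IsBracket br) (a b c d l : ℂ) :
    br (a - b + l) * br (c - d + l) * br (a - d) * br (c - b)
      - br (a - d + l) * br (c - b + l) * br (a - b) * br (c - d)
      = br l * br (a - c) * br (d - b) * br (a - b + (l + c - d)) := by
  have h := hb.riemann ((a + c - b - d + 2 * l) / 2) ((a - d - c + b) / 2)
    ((a - b - c + d) / 2) ((a + c - b - d) / 2)
  have e1 : (a + c - b - d + 2 * l) / 2 + (a - d - c + b) / 2 = a - d + l := by ring
  have e2 : (a + c - b - d + 2 * l) / 2 - (a - d - c + b) / 2 = c - b + l := by ring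
  have e3 : (a - b - c + d) / 2 + (a + c - b - d) / 2 = a - b := by ring
  have e4 : (a - b - c + d) / 2 - (a + c - b - d) / 2 = d - c := by ring
  have e5 : (a + c - b - d + 2 * l) / 2 + (a + c - b - d) / 2 = a - b + (l + c - d) := by ring
  have e6 : (a + c - b - d + 2 * l) / 2 - (a + c - b - d) / 2 = l := by ring
  have e7 : (a - d - c + b) / 2 + (a - b - c + d) / 2 = a - c := by ring
  have e8 : (a - d - c + b) / 2 - (a - b - c + d) / 2 = b - d := by ring
  have e9 : (a + c - b - d + 2 * l) / 2 + (a - b - c + d) / 2 = a - b + l := by ring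
  have e10 : (a + c - b - d + 2 * l) / 2 - (a - b - c + d) / 2 = c - d + l := by ring
  have e11 : (a - d - c + b) / 2 + (a + c - b - d) / 2 = a - d := by ring
  have e12 : (a - d - c + b) / 2 - (a + c - b - d) / 2 = b - c := by ring
  rw [e1, e2, e3, e4, e5, e6, e7, e8, e9, e10, e11, e12, hb.swap d c, hb.swap b d,
    hb.swap b c] at h
  linear_combination h

/-- Frobenius' determinant formula. -/
theorem frobenius (hb : IsBracket br) (n : ℕ) (z w : Fin n → ℂ) (l : ℂ)
    (hzw : ∀ i j, br (z i - w j) ≠ 0)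
    (hl : ∀ s : Finset (Fin n), br (l + ∑ i ∈ s, (z i - w i)) ≠ 0) :
    (Matrix.of fun i j => br (z i - w j + l) / (br (z i - w j) * br l)).det
      = br (l + ∑ i, (z i - w i)) / br l
        * (∏ i, ∏ j ∈ Ioi i, br (z j - z i) * br (w i - w j)) / ∏ i, ∏ j, br (z i - w j) := by
  induction n generalizing l with
  | zero =>
    have := hl ∅
    simp at this
    simp [this]
  | succ n ih =>
    have hl0 : br l ≠ 0 := by simpa using hl ∅
    have hl1 : br (l + z 0 - w 0) ≠ 0 := by simpa [add_sub_assoc] using hl {0}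
    have hM : br (z 0 - w 0 + l) = br (l + z 0 - w 0) := by congr 1; ring
    set f : ℂ → ℂ → ℂ := fun l u => br (u + l) / (br u * br l) with hf
    set A : Matrix (Fin (n + 1)) (Fin (n + 1)) ℂ := Matrix.of fun i j => f l (z i - w j) with hA
    have hf0 : f l (z 0 - w 0) ≠ 0 := by
      simp only [hf, hM]
      exact div_ne_zero hl1 (mul_ne_zero (hzw 0 0) hl0)
    set c : Fin (n + 1) → ℂ := fun i => if i = 0 then 0 else
      f l (z i - w 0) / f l (z 0 - w 0) with hc
    set B : Matrix (Fin (n + 1)) (Fin (n + 1)) ℂ :=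
      Matrix.of fun i j => A i j - c i * A 0 j with hB
    have hAB : A.det = B.det := by
      refine Matrix.det_eq_of_forall_row_eq_smul_add_const c 0 (by simp [hc]) ?_
      intro i j
      simp [hB, hc]
    have hB0 : ∀ j, B 0 j = A 0 j := by simp [hB, hc]
    have hBs0 : ∀ i : Fin n, B i.succ 0 = 0 := by
      intro i
      simp only [hB, hc, hA, Matrix.of_apply, Fin.succ_ne_zero, if_false]
      field_simp
      ring
    have hBs : ∀ i j : Fin n, B i.succ j.succ =
        (br (z i.succ - z 0) / br (z i.succ - w 0)) *
          ((br (w 0 - w j.succ) / br (z 0 - w j.succ)) *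
            f (l + z 0 - w 0) (z i.succ - w j.succ)) := by
      intro i j
      simp only [hB, hc, hA, hf, Matrix.of_apply, Fin.succ_ne_zero, if_false, hM]
      have h := hb.minor (z i.succ) (w j.succ) (z 0) (w 0) l
      rw [hM] at h
      have h1 := hzw i.succ 0
      have h2 := hzw i.succ j.succ
      have h3 := hzw 0 j.succ
      have h4 := hzw 0 0
      field_simp
      linear_combination h
    have hdet : B.det = A 0 0 * (Matrix.of fun i j : Fin n =>
        B i.succ j.succ).det := by
      rw [Matrix.det_succ_column_zero, Fin.sum_univ_succ]
      simp only [hBs0, hB0]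
      simp
      left
      rfl
    have hprod : (Matrix.of fun i j : Fin n => B i.succ j.succ).det =
        (∏ i : Fin n, (br (z i.succ - z 0) / br (z i.succ - w 0))) *
          ((∏ j : Fin n, (br (w 0 - w j.succ) / br (z 0 - w j.succ))) *
          (Matrix.of fun i j : Fin n => f (l + z 0 - w 0) (z i.succ - w j.succ)).det) := by
      rw [← Matrix.det_mul_row, ← Matrix.det_mul_column]
      congr 1
      ext i j
      simp only [Matrix.of_apply]
      exact hBs i j
    have hih := ih (fun i => z i.succ) (fun i => w i.succ) (l + z 0 - w 0)
      (fun i j => hzw _ _) (by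
        intro s
        have := hl (insert 0 (s.map (Fin.succEmb n)))
        rw [Finset.sum_insert (by simp)] at this
        simp only [Finset.sum_map, Fin.coe_succEmb] at this
        convert this using 2
        ring)
    have hsum : l + z 0 - w 0 + ∑ i : Fin n, (z i.succ - w i.succ) =
        l + ∑ i, (z i - w i) := by
      rw [Fin.sum_univ_succ]; ring
    change A.det = _
    rw [hAB, hdet, hprod]
    change _ * (_ * (_ * (Matrix.of fun i j : Fin n => br (z i.succ - w j.succ + (l + z 0 - w 0)) /
      (br (z i.succ - w j.succ) * br (l + z 0 - w 0))).det)) = _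
    rw [hih, hsum]
    simp only [Fin.prod_univ_succ, Fin.prod_Ioi_zero, Fin.prod_Ioi_succ, prod_mul_distrib,
      prod_div_distrib]
    simp only [hA, hf, Matrix.of_apply, hM]
    have h1 : ∏ i : Fin n, br (z i.succ - w 0) ≠ 0 := prod_ne_zero_iff.2 fun i _ => hzw _ _
    have h2 : ∏ i : Fin n, br (z 0 - w i.succ) ≠ 0 := prod_ne_zero_iff.2 fun i _ => hzw _ _
    have h3 : ∏ i : Fin n, ∏ j : Fin n, br (z i.succ - w j.succ) ≠ 0 :=
      prod_ne_zero_iff.2 fun i _ => prod_ne_zero_iff.2 fun j _ => hzw _ _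
    have h4 := hzw 0 0
    field_simp

theorem continuous (hb : IsBracket br) : Continuous br := hb.entire.continuous

theorem analyticOnNhd (hb : IsBracket br) : AnalyticOnNhd ℂ br Set.univ :=
  hb.entire.differentiableOn.analyticOnNhd isOpen_univ

theorem eventually_ne_zero (hb : IsBracket br) (c : ℂ) :
    ∀ᶠ s in 𝓝[≠] c, br s ≠ 0 := by
  rcases (hb.analyticOnNhd c trivial).eventually_eq_zero_or_eventually_ne_zero with h | h
  · exact absurd (funext fun z => hb.analyticOnNhd.eqOn_zero_of_preconnected_of_eventuallyEq_zero
      isPreconnected_univ (Set.mem_univ c) h (Set.mem_univ z)) hb.ne_zero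
  · exact h

theorem eventually_add_ne_zero (hb : IsBracket br) (c : ℂ) :
    ∀ᶠ s in 𝓝[≠] (0 : ℂ), br (c + s) ≠ 0 := by
  have h := hb.eventually_ne_zero c
  have ht : Tendsto (fun s : ℂ => c + s) (𝓝[≠] 0) (𝓝[≠] c) := by
    refine tendsto_nhdsWithin_iff.2 ⟨?_, ?_⟩
    · have : Tendsto (fun s : ℂ => c + s) (𝓝 0) (𝓝 (c + 0)) :=
        (continuous_const.add continuous_id).tendsto 0
      rw [add_zero] at this
      exact this.mono_left nhdsWithin_le_nhds
    · filter_upwards [self_mem_nhdsWithin] with s hs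
      simpa using hs
  exact ht.eventually h

/-- The zero of the bracket at the origin is simple. -/
theorem deriv_zero_ne_zero (hb : IsBracket br) : deriv br 0 ≠ 0 := by
  intro h0
  have hd : ∀ c, HasDerivAt br (deriv br c) c := fun c => (hb.entire c).hasDerivAt
  obtain ⟨a, ha⟩ : ∃ a, br a ≠ 0 := by
    by_contra! h
    exact hb.ne_zero (funext h)
  obtain ⟨b, hb1, hb2, hb3⟩ :
      ∃ b, br (a + b) ≠ 0 ∧ br (a + -b) ≠ 0 ∧ br (0 + b) ≠ 0 := by
    have h1 := hb.eventually_add_ne_zero a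
    have h2 : ∀ᶠ s in 𝓝[≠] (0 : ℂ), br (a + -s) ≠ 0 := by
      filter_upwards [hb.eventually_add_ne_zero (-a)] with s hs
      rw [← neg_ne_zero, ← hb.odd]
      simpa [add_comm] using hs
    exact (h1.and (h2.and (hb.eventually_add_ne_zero 0))).exists
  set Q : ℂ → ℂ := fun d => br (a + d) * br (a - d) with hQ
  set R : ℂ → ℂ := fun d => br (b + d) * br (b - d) with hR
  have hQd : Differentiable ℂ Q := by
    have := hb.entire
    simp only [hQ]; fun_prop
  have hRd : Differentiable ℂ R := by
    have := hb.entire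
    simp only [hR]; fun_prop
  have key : ∀ c d, Q c * R d - Q d * R c
      = br (a + b) * br (a - b) * br (c + d) * br (c - d) := by
    intro c d
    simp only [hQ, hR]
    linear_combination -hb.riemann a b c d
  have hwr : ∀ d, deriv Q d * R d - Q d * deriv R d = 0 := by
    intro d
    have h1 : HasDerivAt (fun c => Q c * R d - Q d * R c)
        (deriv Q d * R d - Q d * deriv R d) d :=
      ((hQd d).hasDerivAt.mul_const _).sub ((hRd d).hasDerivAt.const_mul _)
    have h2 : HasDerivAt (fun c => br (a + b) * br (a - b) * br (c + d) * br (c - d))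
        (br (a + b) * br (a - b) * (deriv br (d + d)) * br (d - d)
          + br (a + b) * br (a - b) * br (d + d) * deriv br 0) d := by
      have e1 : HasDerivAt (fun c => br (c + d)) (deriv br (d + d)) d := by
        simpa using (hd (d + d)).comp_add_const d d
      have e2 : HasDerivAt (fun c => br (c - d)) (deriv br 0) d := by
        simpa using (hd (d - d)).comp_sub_const d d
      exact (e1.const_mul _).mul e2
    simp only [key] at h1
    rw [h1.unique h2, h0, sub_self, hb.map_zero]
    ring
  have hR0 : R 0 ≠ 0 := by
    have : br b ≠ 0 := by simpa using hb3
    simp [hR, this]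
  obtain ⟨ε, hε, hball⟩ := Metric.eventually_nhds_iff_ball.1
    (hRd.continuous.continuousAt.eventually_ne hR0)
  have hconst : ∀ d ∈ Metric.ball (0 : ℂ) ε, Q d / R d = Q 0 / R 0 := by
    intro d hdm
    refine (convex_ball (0 : ℂ) ε).is_const_of_fderivWithin_eq_zero (𝕜 := ℂ)
      (f := fun d => Q d / R d) ?_ ?_ hdm (Metric.mem_ball_self hε)
    · intro e he
      exact ((hQd e).div (hRd e) (hball e he)).differentiableWithinAt
    · intro e he
      rw [fderivWithin_of_isOpen Metric.isOpen_ball he]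
      have h1 : HasDerivAt (fun d => Q d / R d)
          ((deriv Q e * R e - Q e * deriv R e) / R e ^ 2) e :=
        (hQd e).hasDerivAt.div (hRd e).hasDerivAt (hball e he)
      rw [hwr, zero_div] at h1
      simpa using h1.hasFDerivAt.fderiv
  have hzero : ∀ᶠ d in 𝓝[≠] (0 : ℂ), br d = 0 := by
    filter_upwards [nhdsWithin_le_nhds (Metric.ball_mem_nhds (0 : ℂ) hε)] with d hdm
    have h1 := key d 0
    have h2 := hconst d hdm
    rw [div_eq_div_iff (hball d hdm) hR0] at h2
    rw [h2, sub_self] at h1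
    have hb2' : br (a - b) ≠ 0 := by rwa [sub_eq_add_neg]
    simpa [hb1, hb2'] using h1.symm
  obtain ⟨d, hd1, hd2⟩ := (hzero.and (hb.eventually_ne_zero 0)).exists
  exact hd2 hd1

end IsBracket

section OffDiag
variable {ι : Type*} [Fintype ι]

theorem prod_offDiag_eq_prod_lt [LinearOrder ι] (q : ι → ι → ℂ) (hq : ∀ i, q i i = 1) :
    ∏ i, ∏ j, q i j = ∏ i, ∏ j, if i < j then q i j * q j i else 1 := by
  have h1 : ∀ i j, q i j = (if i < j then q i j else 1) * (if j < i then q i j else 1) := by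
    intro i j
    rcases lt_trichotomy i j with h | h | h
    · simp [h, h.not_gt]
    · simp [h, hq]
    · simp [h, h.not_gt]
  have h2 : ∏ i, ∏ j, (if j < i then q i j else 1) = ∏ i, ∏ j, (if i < j then q j i else 1) :=
    prod_comm
  calc ∏ i, ∏ j, q i j
      = (∏ i, ∏ j, if i < j then q i j else 1) * ∏ i, ∏ j, (if j < i then q i j else 1) := by
        simp only [← prod_mul_distrib, ← h1]
    _ = _ := by
        rw [h2]
        simp only [← prod_mul_distrib]
        refine prod_congr rfl fun i _ => prod_congr rfl fun j _ => ?_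
        split_ifs <;> simp

theorem prod_compl_eq_prod_ite [DecidableEq ι] (K : Finset ι) (h : ι → ι → ℂ) :
    ∏ i ∈ K, ∏ j ∈ Kᶜ, h i j = ∏ i, ∏ j, if i ∈ K ∧ j ∉ K then h i j else 1 := by
  rw [← Finset.prod_filter_mul_prod_filter_not univ (· ∈ K)]
  rw [Finset.prod_eq_one (s := univ.filter fun x => x ∉ K)]
  · rw [mul_one, Finset.filter_mem_eq_inter, univ_inter]
    refine prod_congr rfl fun i hi => ?_
    simp only [hi, true_and]
    rw [← Finset.prod_filter]
    congr 1
    ext; simp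
  · intro i hi
    simp only [mem_filter, mem_univ, true_and] at hi
    simp [hi]

theorem prod_compl_eq_prod_lt [LinearOrder ι] (K : Finset ι) (h : ι → ι → ℂ) :
    ∏ i ∈ K, ∏ j ∈ Kᶜ, h i j = ∏ i, ∏ j, if i < j then
      (if i ∈ K ∧ j ∉ K then h i j else 1) * (if j ∈ K ∧ i ∉ K then h j i else 1) else 1 := by
  rw [prod_compl_eq_prod_ite, prod_offDiag_eq_prod_lt]
  simp

end OffDiag

section MixedDet
variable {n : ℕ}
open Polynomial

theorem det_add_X_smul (M N : Matrix (Fin n) (Fin n) ℂ) :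
    (M.map C + (X : ℂ[X]) • N.map C).det = ∑ K : Finset (Fin n), X ^ K.card *
      C (Matrix.of fun i j => if i ∈ K then N i j else M i j).det := by
  have h := Matrix.detRowAlternating.map_add_univ
    (fun i => (X : ℂ[X]) • (fun j => C (N i j))) (fun i j => C (M i j))
  rw [add_comm]
  refine Eq.trans h (sum_congr rfl fun K _ => ?_)
  have h2 := (Matrix.detRowAlternating (R := ℂ[X]) (n := Fin n)).toMultilinearMap.map_piecewise_smul
    (fun _ => (X : ℂ[X])) (K.piecewise (fun i j => C (N i j)) (fun i j => C (M i j))) K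
  have e1 : (K.piecewise (fun i => (X : ℂ[X]) • K.piecewise (fun i j => C (N i j))
      (fun i j => C (M i j)) i) (K.piecewise (fun i j => C (N i j)) (fun i j => C (M i j))))
      = K.piecewise (fun i => (X : ℂ[X]) • (fun j => C (N i j))) (fun i j => C (M i j)) := by
    ext1 i
    by_cases hi : i ∈ K <;> simp [hi]
  rw [e1, prod_const] at h2
  refine Eq.trans h2 ?_
  rw [smul_eq_mul]
  congr 1
  rw [RingHom.map_det]
  change Matrix.det _ = _
  congr 1
  refine Matrix.ext fun i j => ?_
  by_cases hi : i ∈ K <;> simp [hi]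

theorem sum_weight_eq_sum_coeff (g : ℕ → ℂ) (d : Finset (Fin n) → ℂ) :
    ∑ K, g K.card * d K = ∑ p ∈ range (n + 1), g p *
      (∑ K : Finset (Fin n), X ^ K.card * C (d K)).coeff p := by
  simp only [finsetSum_coeff, coeff_X_pow_mul', coeff_C, mul_sum]
  rw [sum_comm]
  refine sum_congr rfl fun K _ => ?_
  have hK : K.card ≤ n := by simpa using K.card_le_univ
  rw [sum_eq_single K.card]
  · simp
  · intro p _ hp
    split_ifs with h1 h2
    · omega
    · simp
    · simp
  · intro h
    exact absurd (mem_range.2 (by omega)) h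

theorem sum_det_rows_eq_sum_det_cols (g : ℕ → ℂ) (M N : Matrix (Fin n) (Fin n) ℂ) :
    ∑ K : Finset (Fin n), g K.card * (Matrix.of fun i j => if i ∈ K then N i j else M i j).det
      = ∑ K : Finset (Fin n), g K.card *
        (Matrix.of fun i j => if j ∈ K then N i j else M i j).det := by
  rw [sum_weight_eq_sum_coeff, ← det_add_X_smul]
  have : ∀ K : Finset (Fin n), (Matrix.of fun i j => if j ∈ K then N i j else M i j).det
      = (Matrix.of fun i j => if i ∈ K then N.transpose i j else M.transpose i j).det := by
    intro K
    rw [← Matrix.det_transpose]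
    rfl
  simp only [this]
  rw [sum_weight_eq_sum_coeff, ← det_add_X_smul, ← Matrix.det_transpose]
  rfl

theorem sum_neg_one_pow_det (M N : Matrix (Fin n) (Fin n) ℂ) :
    ∑ K : Finset (Fin n), (-1) ^ K.card *
      (Matrix.of fun i j => if i ∈ K then N i j else M i j).det = (M - N).det := by
  have h := congrArg (Polynomial.evalRingHom (-1 : ℂ)) (det_add_X_smul M N)
  rw [RingHom.map_det] at h
  simp only [map_sum, map_mul, map_pow, coe_evalRingHom, eval_X, eval_C] at h
  rw [← h]
  congr 1
  ext i j
  simp [sub_eq_add_neg]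

end MixedDet

/-- The summand of the source identities attached to the subset `K`. -/
noncomputable def sourceTerm {ι : Type*} [Fintype ι] [DecidableEq ι] (br : ℂ → ℂ) (t : ℂ)
    (z w : ι → ℂ) (K : Finset ι) : ℂ :=
  (∏ a ∈ K, ∏ b ∈ Kᶜ, br (z a - z b - t) / br (z a - z b)) *
    ∏ a, ∏ b, br (z a - w b - if a ∈ K then 0 else t)

namespace IsBracket
variable {br : ℂ → ℂ}

theorem prod_Ioi_eq {n : ℕ} (h : Fin n → Fin n → ℂ) :
    ∏ i, ∏ j ∈ Ioi i, h i j = ∏ i, ∏ j, if i < j then h i j else 1 := by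
  refine prod_congr rfl fun i _ => ?_
  rw [← prod_filter]
  congr 1
  ext; simp

theorem vandermonde_shift (hb : IsBracket br) {n : ℕ} (t : ℂ) (z : Fin n → ℂ)
    (K : Finset (Fin n)) (hz : ∀ i j, i ≠ j → br (z i - z j) ≠ 0) :
    ∏ i, ∏ j ∈ Ioi i, br ((z i - if i ∈ K then t else 0) - (z j - if j ∈ K then t else 0))
      = (∏ i, ∏ j ∈ Ioi i, br (z i - z j)) *
        ∏ a ∈ K, ∏ b ∈ Kᶜ, br (z a - z b - t) / br (z a - z b) := by
  rw [prod_compl_eq_prod_lt, prod_Ioi_eq, prod_Ioi_eq]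
  simp only [← prod_mul_distrib]
  refine prod_congr rfl fun i _ => prod_congr rfl fun j _ => ?_
  by_cases h1 : i < j
  swap
  · simp [h1]
  have h := hz i j h1.ne
  have h' := hz j i h1.ne'
  by_cases hi : i ∈ K <;> by_cases hj : j ∈ K <;> simp [h1, hi, hj]
  · rw [mul_div_cancel₀ _ h]; congr 1; ring
  · rw [hb.swap (z i) (z j), ← neg_mul_eq_neg_mul, mul_div_cancel₀ _ h', ← hb.odd]; congr 1; ring

theorem vandermonde_shift_rev (hb : IsBracket br) {n : ℕ} (t : ℂ) (z : Fin n → ℂ)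
    (K : Finset (Fin n)) (hz : ∀ i j, i ≠ j → br (z i - z j) ≠ 0) :
    ∏ i, ∏ j ∈ Ioi i, br ((z j - if j ∈ K then t else 0) - (z i - if i ∈ K then t else 0))
      = (∏ i, ∏ j ∈ Ioi i, br (z j - z i)) *
        ∏ a ∈ K, ∏ b ∈ Kᶜ, br (z a - z b - t) / br (z a - z b) := by
  have h := hb.vandermonde_shift t z K hz
  have e : ∀ u : Fin n → ℂ, ∏ i, ∏ j ∈ Ioi i, br (u j - u i)
      = (∏ i, ∏ j ∈ Ioi (i : Fin n), (-1 : ℂ)) * ∏ i, ∏ j ∈ Ioi i, br (u i - u j) := by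
    intro u
    simp only [← prod_mul_distrib]
    refine prod_congr rfl fun i _ => prod_congr rfl fun j _ => ?_
    rw [hb.swap]; ring
  rw [e (fun i => z i - if i ∈ K then t else 0), h, e z]
  ring

/-- The prefactor in the evaluation of the mixed determinants. -/
noncomputable def mixedPrefactor (br : ℂ → ℂ) {n : ℕ} (t l : ℂ) (z w : Fin n → ℂ) : ℂ :=
  (∏ i, ∏ j ∈ Ioi i, br (z j - z i) * br (w i - w j)) /
    (br l * ((∏ i, ∏ j, br (z i - w j)) * ∏ i, ∏ j, br (z i - w j - t)))

/-- The elliptic Cauchy kernel. -/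
noncomputable def kernel (br : ℂ → ℂ) (l u : ℂ) : ℂ := br (u + l) / (br u * br l)

section
variable {n : ℕ} (t l : ℂ) (z w : Fin n → ℂ) (K : Finset (Fin n))

theorem sum_ite_mem_const : ∑ i, (if i ∈ K then t else 0) = (K.card : ℂ) * t := by
  rw [← sum_filter, filter_mem_eq_inter, univ_inter, sum_const, nsmul_eq_mul]

theorem det_mixed_rows (hb : IsBracket br)
    (hz : ∀ i j, i ≠ j → br (z i - z j) ≠ 0)
    (h0 : ∀ i j, br (z i - w j) ≠ 0) (ht : ∀ i j, br (z i - w j - t) ≠ 0)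
    (hl : ∀ s : Finset (Fin n), br (l + ∑ i ∈ s, (z i - (if i ∈ K then t else 0) - w i)) ≠ 0) :
    (Matrix.of fun i j => if i ∈ K then kernel br l (z i - w j - t)
        else kernel br l (z i - w j)).det
      = mixedPrefactor br t l z w *
        (br (l + ∑ i, (z i - w i) - K.card * t) * sourceTerm br t z w K) := by
  have hF := hb.frobenius n (fun i => z i - if i ∈ K then t else 0) w l ?_ hl
  · have hl0 : br l ≠ 0 := by simpa using hl ∅
    have hM : (Matrix.of fun i j => if i ∈ K then kernel br l (z i - w j - t)
        else kernel br l (z i - w j)) = Matrix.of fun i j =>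
          br (z i - (if i ∈ K then t else 0) - w j + l) /
            (br (z i - (if i ∈ K then t else 0) - w j) * br l) := by
      refine Matrix.ext fun i j => ?_
      simp only [Matrix.of_apply, kernel]
      split_ifs <;> simp [sub_right_comm]
    rw [hM, hF]
    simp only [prod_mul_distrib, hb.vandermonde_shift_rev t z K hz]
    have hs : ∑ i, (z i - (if i ∈ K then t else 0) - w i)
        = ∑ i, (z i - w i) - K.card * t := by
      rw [← sum_ite_mem_const, ← sum_sub_distrib]
      exact sum_congr rfl fun i _ => by ring
    have hd : (∏ i, ∏ j, br (z i - (if i ∈ K then t else 0) - w j)) *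
        (∏ i, ∏ j, br (z i - w j - if i ∈ K then 0 else t))
        = (∏ i, ∏ j, br (z i - w j)) * ∏ i, ∏ j, br (z i - w j - t) := by
      simp only [← prod_mul_distrib]
      refine prod_congr rfl fun i _ => prod_congr rfl fun j _ => ?_
      split_ifs
      · simp [sub_right_comm, mul_comm]
      · simp
    have hA : (∏ i, ∏ j, br (z i - (if i ∈ K then t else 0) - w j)) ≠ 0 := by
      refine prod_ne_zero_iff.2 fun i _ => prod_ne_zero_iff.2 fun j _ => ?_
      split_ifs
      · rw [sub_right_comm]; exact ht i j
      · simpa using h0 i j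
    have hB : (∏ i, ∏ j, br (z i - w j - if i ∈ K then 0 else t)) ≠ 0 := by
      refine prod_ne_zero_iff.2 fun i _ => prod_ne_zero_iff.2 fun j _ => ?_
      split_ifs
      · simpa using h0 i j
      · exact ht i j
    rw [hs, ← add_sub_assoc, mixedPrefactor, sourceTerm, ← hd]
    simp only [prod_mul_distrib]
    field_simp
  · intro i j
    split_ifs
    · rw [sub_right_comm]; exact ht i j
    · simpa using h0 i j

theorem det_mixed_cols (hb : IsBracket br)
    (hw : ∀ i j, i ≠ j → br (w i - w j) ≠ 0)
    (h0 : ∀ i j, br (z i - w j) ≠ 0) (ht : ∀ i j, br (z i - w j - t) ≠ 0)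
    (hl : ∀ s : Finset (Fin n), br (l + ∑ i ∈ s, (z i - (w i - if i ∈ K then -t else 0))) ≠ 0) :
    (Matrix.of fun i j => if j ∈ K then kernel br l (z i - w j - t)
        else kernel br l (z i - w j)).det
      = mixedPrefactor br t l z w * (br (l + ∑ i, (z i - w i) - K.card * t) *
        ((-1) ^ n * sourceTerm br (-t) w z K)) := by
  have hF := hb.frobenius n z (fun i => w i - if i ∈ K then -t else 0) l ?_ hl
  · have hl0 : br l ≠ 0 := by simpa using hl ∅
    have hM : (Matrix.of fun i j => if j ∈ K then kernel br l (z i - w j - t)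
        else kernel br l (z i - w j)) = Matrix.of fun i j =>
          br (z i - (w j - if j ∈ K then -t else 0) + l) /
            (br (z i - (w j - if j ∈ K then -t else 0)) * br l) := by
      refine Matrix.ext fun i j => ?_
      simp only [Matrix.of_apply, kernel]
      split_ifs <;> simp [sub_sub]
    rw [hM, hF]
    simp only [prod_mul_distrib, hb.vandermonde_shift (-t) w K hw]
    have hs : ∑ i, (z i - (w i - if i ∈ K then -t else 0))
        = ∑ i, (z i - w i) - K.card * t := by
      rw [← sum_ite_mem_const, ← sum_sub_distrib]
      refine sum_congr rfl fun i _ => ?_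
      split_ifs <;> ring
    have hd : (∏ i, ∏ j, br (z i - (w j - if j ∈ K then -t else 0))) *
        ((-1) ^ n * ∏ j, ∏ i, br (w j - z i - if j ∈ K then 0 else -t))
        = (∏ i, ∏ j, br (z i - w j)) * ∏ i, ∏ j, br (z i - w j - t) := by
      have hn : ((-1 : ℂ)) ^ n = ∏ i : Fin n, ∏ j : Fin n, (-1) := by
        simp only [prod_const, card_univ, Fintype.card_fin, ← pow_mul]
        rcases Nat.even_or_odd n with h | h
        · rw [h.neg_one_pow, (h.mul_right n).neg_one_pow]
        · rw [h.neg_one_pow, (h.mul h).neg_one_pow]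
      rw [hn, prod_comm (f := fun j i => br (w j - z i - if j ∈ K then 0 else -t))]
      simp only [← prod_mul_distrib]
      refine prod_congr rfl fun i _ => prod_congr rfl fun j _ => ?_
      have e : ∀ a, -1 * br a = br (-a) := fun a => by rw [hb.odd]; ring
      rw [e]
      split_ifs
      · rw [mul_comm]; congr 2 <;> ring
      · congr 2 <;> ring
    have hA : (∏ i, ∏ j, br (z i - (w j - if j ∈ K then -t else 0))) ≠ 0 := by
      refine prod_ne_zero_iff.2 fun i _ => prod_ne_zero_iff.2 fun j _ => ?_
      split_ifs
      · simpa [sub_sub] using ht i j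
      · simpa using h0 i j
    have hB : ((-1) ^ n * ∏ j, ∏ i, br (w j - z i - if j ∈ K then 0 else -t)) ≠ 0 := by
      intro h
      rw [h, mul_zero] at hd
      refine mul_ne_zero ?_ ?_ hd.symm <;>
        refine prod_ne_zero_iff.2 fun i _ => prod_ne_zero_iff.2 fun j _ => ?_
      · exact h0 i j
      · exact ht i j
    rw [hs, ← add_sub_assoc, mixedPrefactor, sourceTerm, ← hd]
    simp only [prod_mul_distrib]
    generalize (∏ j, ∏ i, br (w j - z i - if j ∈ K then 0 else -t)) = B at hB ⊢
    have hB' := right_ne_zero_of_mul hB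
    field_simp
  · intro i j
    split_ifs
    · simpa [sub_sub] using ht i j
    · simpa using h0 i j

end
end IsBracket

theorem eq_zero_of_eventually_eq {f g : ℂ → ℂ} (hf : Continuous f) (hg : Continuous g)
    (h : ∀ᶠ s in 𝓝[≠] (0 : ℂ), f s = g s) : f 0 = g 0 :=
  tendsto_nhds_unique_of_eventuallyEq ((hf.tendsto 0).mono_left nhdsWithin_le_nhds)
    ((hg.tendsto 0).mono_left nhdsWithin_le_nhds) h

theorem sourceTerm_map {ι ι' : Type*} [Fintype ι] [DecidableEq ι] [Fintype ι'] [DecidableEq ι']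
    (br : ℂ → ℂ) (t : ℂ) (z w : ι → ℂ) (e : ι ≃ ι') (K : Finset ι) :
    sourceTerm br t (z ∘ e.symm) (w ∘ e.symm) (e.finsetCongr K) = sourceTerm br t z w K := by
  simp only [sourceTerm, prod_compl_eq_prod_ite]
  congr 1
  · refine (Fintype.prod_equiv e _ _ fun a => Fintype.prod_equiv e _ _ fun b => ?_).symm
    simp
  · refine (Fintype.prod_equiv e _ _ fun a => Fintype.prod_equiv e _ _ fun b => ?_).symm
    simp

namespace IsBracket
variable {br : ℂ → ℂ}

theorem mixedPrefactor_ne_zero {n : ℕ} (t l : ℂ) (z w : Fin n → ℂ)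
    (hz : ∀ i j, i ≠ j → br (z i - z j) ≠ 0) (hw : ∀ i j, i ≠ j → br (w i - w j) ≠ 0)
    (h0 : ∀ i j, br (z i - w j) ≠ 0) (ht : ∀ i j, br (z i - w j - t) ≠ 0) (hl : br l ≠ 0) :
    mixedPrefactor br t l z w ≠ 0 := by
  refine div_ne_zero ?_ (mul_ne_zero hl (mul_ne_zero ?_ ?_)) <;>
    refine prod_ne_zero_iff.2 fun i _ => prod_ne_zero_iff.2 fun j hj => ?_
  · rw [mem_Ioi] at hj
    exact mul_ne_zero (hz _ _ hj.ne') (hw _ _ hj.ne)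
  · exact h0 i j
  · exact ht i j

theorem eventually_subset_sum_ne_zero (hb : IsBracket br) {n : ℕ}
    (u : Finset (Fin n) → Fin n → ℂ) :
    ∀ᶠ l in 𝓝[≠] (0 : ℂ), ∀ K s, br (l + ∑ i ∈ s, u K i) ≠ 0 := by
  refine eventually_all.2 fun K => eventually_all.2 fun s => ?_
  filter_upwards [hb.eventually_add_ne_zero (∑ i ∈ s, u K i)] with l hl
  rwa [add_comm]

theorem eventually_perturbed_ne_zero (hb : IsBracket br) {n : ℕ} (t : ℂ) (z w : Fin n → ℂ) :
    ∀ᶠ s in 𝓝[≠] (0 : ℂ), ∀ i j, br (z i - (w j + s) - t) ≠ 0 := by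
  refine eventually_all.2 fun i => eventually_all.2 fun j => ?_
  filter_upwards [hb.eventually_add_ne_zero (-(z i - w j - t))] with s hs
  rw [← neg_ne_zero, ← hb.odd]
  convert hs using 2
  ring

theorem continuous_sourceTerm_right (hb : IsBracket br) {n : ℕ} (t : ℂ) (z w : Fin n → ℂ)
    (K : Finset (Fin n)) : Continuous fun s : ℂ => sourceTerm br t z (fun b => w b + s) K := by
  have hc := hb.continuous
  unfold sourceTerm
  fun_prop

theorem continuous_sourceTerm_left (hb : IsBracket br) {n : ℕ} (t : ℂ) (z w : Fin n → ℂ)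
    (K : Finset (Fin n)) : Continuous fun s : ℂ => sourceTerm br t (fun b => z b + s) w K := by
  have hc := hb.continuous
  unfold sourceTerm
  simp only [add_sub_add_right_eq_sub]
  fun_prop

section
variable {n : ℕ} (t : ℂ) (z w : Fin n → ℂ)

theorem sum_sourceTerm_fin_of_ne_zero (hb : IsBracket br) (g : ℕ → ℂ)
    (hz : ∀ i j, i ≠ j → br (z i - z j) ≠ 0) (hw : ∀ i j, i ≠ j → br (w i - w j) ≠ 0)
    (h0 : ∀ i j, br (z i - w j) ≠ 0) (ht : ∀ i j, br (z i - w j - t) ≠ 0) :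
    ∑ K : Finset (Fin n), g K.card * sourceTerm br t z w K
      = (-1) ^ n * ∑ K : Finset (Fin n), g K.card * sourceTerm br (-t) w z K := by
  obtain ⟨l, hl1, hl2⟩ := ((hb.eventually_subset_sum_ne_zero
    (fun K i => z i - (if i ∈ K then t else 0) - w i)).and (hb.eventually_subset_sum_ne_zero
    (fun K i => z i - (w i - if i ∈ K then -t else 0)))).exists
  have hl0 : br l ≠ 0 := by simpa using hl1 ∅ ∅
  have hC := mixedPrefactor_ne_zero t l z w hz hw h0 ht hl0
  have hs : ∀ K : Finset (Fin n), br (l + ∑ i, (z i - w i) - K.card * t) ≠ 0 := by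
    intro K
    convert hl1 K univ using 2
    rw [add_sub_assoc, ← sum_ite_mem_const, ← sum_sub_distrib]
    exact congrArg _ (sum_congr rfl fun i _ => by ring)
  have h := sum_det_rows_eq_sum_det_cols (fun p => g p / br (l + ∑ i, (z i - w i) - p * t))
    (Matrix.of fun i j => kernel br l (z i - w j)) (Matrix.of fun i j => kernel br l (z i - w j - t))
  simp only [Matrix.of_apply] at h
  have hL : ∀ K : Finset (Fin n), g K.card / br (l + ∑ i, (z i - w i) - K.card * t) *
      (Matrix.of fun i j => if i ∈ K then kernel br l (z i - w j - t)
        else kernel br l (z i - w j)).det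
      = mixedPrefactor br t l z w * (g K.card * sourceTerm br t z w K) := by
    intro K
    rw [det_mixed_rows t l z w K hb hz h0 ht (hl1 K)]
    have := hs K
    field_simp
  have hR : ∀ K : Finset (Fin n), g K.card / br (l + ∑ i, (z i - w i) - K.card * t) *
      (Matrix.of fun i j => if j ∈ K then kernel br l (z i - w j - t)
        else kernel br l (z i - w j)).det
      = mixedPrefactor br t l z w * ((-1) ^ n * (g K.card * sourceTerm br (-t) w z K)) := by
    intro K
    rw [det_mixed_cols t l z w K hb hw h0 ht (hl2 K)]
    have := hs K
    field_simp
  simp only [hL, hR, ← mul_sum] at h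
  exact mul_left_cancel₀ hC h

theorem sum_sourceTerm_fin (hb : IsBracket br) (g : ℕ → ℂ)
    (hz : ∀ i j, i ≠ j → br (z i - z j) ≠ 0) (hw : ∀ i j, i ≠ j → br (w i - w j) ≠ 0) :
    ∑ K : Finset (Fin n), g K.card * sourceTerm br t z w K
      = (-1) ^ n * ∑ K : Finset (Fin n), g K.card * sourceTerm br (-t) w z K := by
  have hL := fun K => hb.continuous_sourceTerm_right t z w K
  have hR := fun K => hb.continuous_sourceTerm_left (-t) w z K
  have h := eq_zero_of_eventually_eq
    (f := fun s => ∑ K : Finset (Fin n), g K.card * sourceTerm br t z (fun b => w b + s) K)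
    (g := fun s => (-1) ^ n *
      ∑ K : Finset (Fin n), g K.card * sourceTerm br (-t) (fun b => w b + s) z K)
    (by fun_prop) (by fun_prop) ?_
  · simpa using h
  · filter_upwards [hb.eventually_perturbed_ne_zero 0 z w,
      hb.eventually_perturbed_ne_zero t z w] with s h0 ht
    refine sum_sourceTerm_fin_of_ne_zero t z (fun b => w b + s) hb g hz ?_ ?_ ht
    · intro i j hij
      simpa using hw i j hij
    · simpa using h0

theorem tendsto_kernel_sub_kernel (hb : IsBracket br) (u v : ℂ) (hu : br u ≠ 0) (hv : br v ≠ 0) :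
    ∃ c, Tendsto (fun l => kernel br l u - kernel br l v) (𝓝[≠] 0) (𝓝 c) := by
  have hd : HasDerivAt (fun l => br (u + l) / br u - br (v + l) / br v)
      (deriv br u / br u - deriv br v / br v) 0 := by
    have e : ∀ a : ℂ, HasDerivAt (fun l => br (a + l)) (deriv br a) 0 := by
      intro a
      have := (hb.entire (a + 0)).hasDerivAt.comp_const_add a 0
      simpa using this
    exact ((e u).div_const _).sub ((e v).div_const _)
  have h0 : HasDerivAt br (deriv br 0) 0 := (hb.entire 0).hasDerivAt
  rw [hasDerivAt_iff_tendsto_slope_zero] at hd h0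
  refine ⟨_, (hd.div h0 hb.deriv_zero_ne_zero).congr' ?_⟩
  filter_upwards [self_mem_nhdsWithin, hb.eventually_ne_zero 0] with l hl hbl
  have hl' : l ≠ 0 := hl
  simp only [zero_add, add_zero, hb.map_zero, sub_zero, div_self hu, div_self hv, sub_self,
    smul_eq_mul, kernel, Pi.div_apply]
  field_simp

theorem sum_neg_one_pow_sourceTerm_fin_of_ne_zero (hb : IsBracket br)
    (hz : ∀ i j, i ≠ j → br (z i - z j) ≠ 0) (hw : ∀ i j, i ≠ j → br (w i - w j) ≠ 0)
    (h0 : ∀ i j, br (z i - w j) ≠ 0) (ht : ∀ i j, br (z i - w j - t) ≠ 0) :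
    ∑ K : Finset (Fin n), (-1) ^ K.card *
      (br (∑ i, (z i - w i) - K.card * t) * sourceTerm br t z w K) = 0 := by
  choose c hc using fun i j => hb.tendsto_kernel_sub_kernel _ _ (h0 i j) (ht i j)
  have hdet : Tendsto (fun l => ((Matrix.of fun i j => kernel br l (z i - w j)) -
      Matrix.of fun i j => kernel br l (z i - w j - t)).det) (𝓝[≠] 0) (𝓝 (Matrix.of c).det) := by
    have hcont : Continuous fun A : Matrix (Fin n) (Fin n) ℂ => A.det := continuous_id.matrix_det
    refine (hcont.tendsto (Matrix.of c)).comp ?_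
    exact tendsto_pi_nhds.2 fun i => tendsto_pi_nhds.2 fun j => hc i j
  set C0 := (∏ i, ∏ j ∈ Ioi i, br (z j - z i) * br (w i - w j)) /
    ((∏ i, ∏ j, br (z i - w j)) * ∏ i, ∏ j, br (z i - w j - t)) with hC0
  have hpre : ∀ l, mixedPrefactor br t l z w = C0 / br l := by
    intro l
    rw [mixedPrefactor, mul_comm (br l), ← div_div, ← hC0]
  have hC0' : C0 ≠ 0 := by
    obtain ⟨l, hl⟩ := (hb.eventually_ne_zero 0).exists
    have := mixedPrefactor_ne_zero t l z w hz hw h0 ht hl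
    intro h
    refine this ?_
    rw [hpre, h, zero_div]
  have h1 : ∀ᶠ l in 𝓝[≠] (0 : ℂ), C0 * ∑ K : Finset (Fin n), (-1) ^ K.card *
      (br (l + ∑ i, (z i - w i) - K.card * t) * sourceTerm br t z w K)
      = br l * ((Matrix.of fun i j => kernel br l (z i - w j)) -
        Matrix.of fun i j => kernel br l (z i - w j - t)).det := by
    filter_upwards [hb.eventually_subset_sum_ne_zero
      (fun K i => z i - (if i ∈ K then t else 0) - w i)] with l hl
    have hl0 : br l ≠ 0 := by simpa using hl ∅ ∅
    rw [← sum_neg_one_pow_det]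
    simp only [Matrix.of_apply, mul_sum]
    refine sum_congr rfl fun K _ => ?_
    rw [det_mixed_rows t l z w K hb hz h0 ht (hl K), hpre]
    field_simp
  have h2 : Tendsto (fun l => C0 * ∑ K : Finset (Fin n), (-1) ^ K.card *
      (br (l + ∑ i, (z i - w i) - K.card * t) * sourceTerm br t z w K)) (𝓝[≠] 0)
      (𝓝 (C0 * ∑ K : Finset (Fin n), (-1) ^ K.card *
      (br (0 + ∑ i, (z i - w i) - K.card * t) * sourceTerm br t z w K))) := by
    have hcb := hb.continuous
    refine Tendsto.mono_left (Continuous.tendsto (f := fun l => C0 * ∑ K : Finset (Fin n),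
      (-1) ^ K.card * (br (l + ∑ i, (z i - w i) - K.card * t) * sourceTerm br t z w K))
      ?_ 0) nhdsWithin_le_nhds
    fun_prop
  have h3 := ((hb.continuous.tendsto 0).mono_left nhdsWithin_le_nhds).mul hdet
  rw [hb.map_zero, zero_mul] at h3
  have h4 := tendsto_nhds_unique_of_eventuallyEq h2 h3 h1
  simpa [hC0'] using h4

theorem sum_neg_one_pow_sourceTerm_fin (hb : IsBracket br)
    (hz : ∀ i j, i ≠ j → br (z i - z j) ≠ 0) (hw : ∀ i j, i ≠ j → br (w i - w j) ≠ 0) :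
    ∑ K : Finset (Fin n), (-1) ^ K.card *
      (br (∑ i, (z i - w i) - K.card * t) * sourceTerm br t z w K) = 0 := by
  have hL := fun K => hb.continuous_sourceTerm_right t z w K
  have hcb := hb.continuous
  have h := eq_zero_of_eventually_eq
    (f := fun s => ∑ K : Finset (Fin n), (-1) ^ K.card *
      (br (∑ i, (z i - (w i + s)) - K.card * t) * sourceTerm br t z (fun b => w b + s) K))
    (g := fun s => 0) (by fun_prop) (by fun_prop) ?_
  · simpa using h
  · filter_upwards [hb.eventually_perturbed_ne_zero 0 z w,
      hb.eventually_perturbed_ne_zero t z w] with s h0 ht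
    refine sum_neg_one_pow_sourceTerm_fin_of_ne_zero t z (fun b => w b + s) hb hz ?_ ?_ ht
    · intro i j hij
      simpa using hw i j hij
    · simpa using h0
end

section
variable {ι : Type*} [Fintype ι] [DecidableEq ι] (t : ℂ) (z w : ι → ℂ)

/-- Duality of the source sums. -/
theorem sum_sourceTerm (hb : IsBracket br) (g : ℕ → ℂ)
    (hz : ∀ i j, i ≠ j → br (z i - z j) ≠ 0) (hw : ∀ i j, i ≠ j → br (w i - w j) ≠ 0) :
    ∑ K : Finset ι, g K.card * sourceTerm br t z w K
      = (-1) ^ Fintype.card ι * ∑ K : Finset ι, g K.card * sourceTerm br (-t) w z K := by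
  set e := Fintype.equivFin ι
  have h := hb.sum_sourceTerm_fin t (z ∘ e.symm) (w ∘ e.symm) g
    (fun i j hij => hz _ _ (e.symm.injective.ne hij))
    (fun i j hij => hw _ _ (e.symm.injective.ne hij))
  rw [← e.finsetCongr.sum_comp, ← e.finsetCongr.sum_comp] at h
  have hm := fun K => sourceTerm_map br t z w e K
  have hm' := fun K => sourceTerm_map br (-t) w z e K
  simp only [Equiv.finsetCongr_apply] at hm hm' h
  simpa only [hm, hm', card_map] using h

theorem sum_neg_one_pow_sourceTerm (hb : IsBracket br)
    (hz : ∀ i j, i ≠ j → br (z i - z j) ≠ 0) (hw : ∀ i j, i ≠ j → br (w i - w j) ≠ 0) :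
    ∑ K : Finset ι, (-1) ^ K.card *
      (br (∑ i, (z i - w i) - K.card * t) * sourceTerm br t z w K) = 0 := by
  set e := Fintype.equivFin ι
  have h := hb.sum_neg_one_pow_sourceTerm_fin t (z ∘ e.symm) (w ∘ e.symm)
    (fun i j hij => hz _ _ (e.symm.injective.ne hij))
    (fun i j hij => hw _ _ (e.symm.injective.ne hij))
  rw [← e.finsetCongr.sum_comp] at h
  have hs : ∑ i, ((z ∘ e.symm) i - (w ∘ e.symm) i) = ∑ i, (z i - w i) :=
    e.symm.sum_comp fun i => z i - w i
  rw [hs] at h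
  have hm := fun K => sourceTerm_map br t z w e K
  simp only [Equiv.finsetCongr_apply] at hm h
  simpa only [hm, card_map] using h
end

end IsBracket

section sfac
variable (br : ℂ → ℂ) (a x : ℂ) (n : ℕ)

theorem sfac_natCast : sfac br a x (n : ℤ) = ∏ i ∈ range n, br (x + (i : ℂ) * a) := by
  simp [sfac]

theorem sfac_succ : sfac br a x ((n + 1 : ℕ) : ℤ) = sfac br a x (n : ℤ) * br (x + (n : ℂ) * a) := by
  rw [sfac_natCast, sfac_natCast, prod_range_succ]

theorem sfac_succ_left :
    sfac br a x ((n + 1 : ℕ) : ℤ) = br x * sfac br a (x + a) (n : ℤ) := by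
  rw [sfac_natCast, sfac_natCast, prod_range_succ', mul_comm]
  congr 1
  · simp
  · refine prod_congr rfl fun i _ => ?_
    congr 1
    push_cast
    ring
end sfac

/-- All brackets of differences of coordinates, shifted by integer combinations of `a` and `b`,
are nonzero, apart from the bracket of zero. -/
def Spread {ι : Type*} (br : ℂ → ℂ) (a b : ℂ) (x : ι → ℂ) : Prop :=
  ∀ i j (p q : ℤ), (i = j → p ≠ 0 ∨ q ≠ 0) → br (x i - x j + (p * a + q * b)) ≠ 0

namespace Spread
variable {ι : Type*} {br : ℂ → ℂ} {a b : ℂ} {x : ι → ℂ}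

theorem ne_zero (h : Spread br a b x) (i j : ι) (p q : ℤ) (hpq : i = j → p ≠ 0 ∨ q ≠ 0)
    {u : ℂ} (hu : u = x i - x j + (p * a + q * b)) : br u ≠ 0 := hu ▸ h i j p q hpq

theorem sfac_left_ne_zero (h : Spread br a b x) (i j : ι) (n : ℕ) :
    sfac br a (x i - x j + a) (n : ℤ) ≠ 0 := by
  rw [sfac_natCast]
  refine prod_ne_zero_iff.2 fun k _ => h.ne_zero i j (k + 1) 0 (fun _ => Or.inl (by omega)) ?_
  push_cast; ring

end Spread

namespace IsBracket
variable {br : ℂ → ℂ}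

theorem block_forward {m : ℕ} {a b : ℂ} {x : Fin m → ℂ} (hb : IsBracket br)
    (hx : Spread br a b x)
    (μ n : Fin m → ℕ) (J : Finset (Fin m)) (hn : ∀ i, n i = if i ∈ J then μ i else μ i + 1)
    (X : Fin m → ℂ) (hX : ∀ i, X i = x i + a * (n i - 1)) :
    (∏ i, ∏ j, if i < j then br (x i - x j + ((μ i : ℂ) - (μ j : ℂ)) * a) / br (x i - x j) else 1)
      * (∏ i, ∏ j, sfac br a (x i - x j + b) (μ i : ℤ) / sfac br a (x i - x j + a) (μ i : ℤ))
      * (∏ i ∈ J, ∏ j ∈ Jᶜ, br (x i + a * μ i - (x j + a * μ j) - b)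
          / br (x i + a * μ i - (x j + a * μ j)))
    = (∏ i, ∏ j, if i < j then br (X i - X j) / br (x i - x j) else 1)
      * (∏ i, ∏ j, sfac br a (x i - x j + b) (n i : ℤ) /
          (sfac br a (x i - x j + a) (n i : ℤ) * br (X i - x j + b)))
      * ((∏ i ∈ J, ∏ j ∈ Jᶜ, br (X i - X j - (b - a)) / br (X i - X j))
        * ∏ i, ∏ j, br (X i - x j + b - if i ∈ J then 0 else b - a)) := by
  have hXn : ∀ i j, br (X i - x j + b) ≠ 0 := by
    intro i j
    refine hx.ne_zero i j (n i - 1) 1 (fun _ => Or.inr one_ne_zero) ?_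
    rw [hX]; push_cast; ring
  have hS : ∀ i j, sfac br a (x i - x j + b) (μ i : ℤ) / sfac br a (x i - x j + a) (μ i : ℤ)
      = sfac br a (x i - x j + b) (n i : ℤ) /
          (sfac br a (x i - x j + a) (n i : ℤ) * br (X i - x j + b))
        * br (X i - x j + b - if i ∈ J then 0 else b - a) := by
    intro i j
    have h1 := hx.sfac_left_ne_zero i j (n i)
    have h2 := hXn i j
    have h3 := hx.sfac_left_ne_zero i j (μ i)
    by_cases hi : i ∈ J
    · simp only [hn i, hi, if_true, sub_zero] at h1 ⊢
      field_simp
    · have e1 : X i - x j + b = x i - x j + b + (μ i : ℂ) * a := by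
        rw [hX, hn i, if_neg hi]; push_cast; ring
      have e2 : X i - x j + b - (b - a) = x i - x j + a + (μ i : ℂ) * a := by
        rw [hX, hn i, if_neg hi]; push_cast; ring
      rw [e1] at h2
      simp only [hn i, hi, if_false, e2] at h1 ⊢
      rw [e1, sfac_succ, sfac_succ]
      rw [sfac_succ] at h1
      have h4 := right_ne_zero_of_mul h1
      generalize br (x i - x j + a + (μ i : ℂ) * a) = A at h4 ⊢
      generalize br (x i - x j + b + (μ i : ℂ) * a) = B at h2 ⊢
      field_simp
  have hV : (∏ i, ∏ j, if i < j then br (x i - x j + ((μ i : ℂ) - (μ j : ℂ)) * a) /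
        br (x i - x j) else 1)
      * (∏ i ∈ J, ∏ j ∈ Jᶜ, br (x i + a * μ i - (x j + a * μ j) - b)
          / br (x i + a * μ i - (x j + a * μ j)))
      = (∏ i, ∏ j, if i < j then br (X i - X j) / br (x i - x j) else 1)
        * (∏ i ∈ J, ∏ j ∈ Jᶜ, br (X i - X j - (b - a)) / br (X i - X j)) := by
    rw [prod_compl_eq_prod_lt, prod_compl_eq_prod_lt]
    simp only [← prod_mul_distrib]
    refine prod_congr rfl fun i _ => prod_congr rfl fun j _ => ?_
    by_cases hij : i < j
    swap
    · simp [hij]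
    have hU : ∀ i j : Fin m, i ≠ j → br (X i - X j) ≠ 0 := fun i j h =>
      hx.ne_zero i j (n i - n j) 0 (fun h' => absurd h' h)
        (by rw [hX, hX]; push_cast; ring)
    have hU' : ∀ i j : Fin m, i ≠ j → br (x i + a * μ i - (x j + a * μ j)) ≠ 0 := fun i j h =>
      hx.ne_zero i j (μ i - μ j) 0 (fun h' => absurd h' h)
        (by push_cast; ring)
    have h1 := hU i j hij.ne
    have h2 := hU' i j hij.ne
    have h1' := hU j i hij.ne'
    have h2' := hU' j i hij.ne'
    have e0 : x i - x j + ((μ i : ℂ) - μ j) * a = x i + a * μ i - (x j + a * μ j) := by ring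
    rw [e0]
    by_cases hi : i ∈ J <;> by_cases hj : j ∈ J <;> simp only [hi, hj, hij, if_true, if_false,
      and_true, and_false, not_true, not_false_eq_true, mul_one, one_mul]
    · congr 2; rw [hX, hX, hn, hn, if_pos hi, if_pos hj]; ring
    · have : X i - X j - (b - a) = x i + a * μ i - (x j + a * μ j) - b := by
        rw [hX, hX, hn, hn, if_pos hi, if_neg hj]; push_cast; ring
      rw [this]
      field_simp
    · have : X j - X i - (b - a) = x j + a * μ j - (x i + a * μ i) - b := by
        rw [hX, hX, hn, hn, if_pos hj, if_neg hi]; push_cast; ring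
      rw [this, hb.swap (X i), hb.swap (x i + _)]
      field_simp
    · congr 2; rw [hX, hX, hn, hn, if_neg hi, if_neg hj]; push_cast; ring
  simp only [hS, prod_mul_distrib]
  linear_combination (∏ i, ∏ j, sfac br a (x i - x j + b) (n i : ℤ) /
          (sfac br a (x i - x j + a) (n i : ℤ) * br (X i - x j + b)))
          * (∏ i, ∏ j, br (X i - x j + b - if i ∈ J then 0 else b - a)) * hV

theorem sfac_ratio_backward (hb : IsBracket br) {m : ℕ} {a b : ℂ} {y : Fin m → ℂ}
    (hy : Spread br a b y)
    (ν n : Fin m → ℕ) (I : Finset (Fin m)) (hn : ∀ i, n i = if i ∈ I then ν i else ν i + 1)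
    (Y y' : Fin m → ℂ) (hY : ∀ i, Y i = y i + a * (n i - 1)) (c : ℂ)
    (hy' : ∀ i, y' i = y i - a * (if i ∈ I then 1 else 0) + c) (i j : Fin m) :
    sfac br a (y' i - y' j + b) (ν i : ℤ) / sfac br a (y' i - y' j + a) (ν i : ℤ)
      = sfac br a (y i - y j + b) (n i : ℤ) /
          (sfac br a (y i - y j + a) (n i : ℤ) * br (y j - Y i - b))
        * br (y j - Y i - b - if j ∈ I then 0 else a - b)
        * (if i ∈ I ∧ j ∉ I then br (y i - y j - (a - b)) / br (y i - y j)
          else if j ∈ I ∧ i ∉ I then br (y i - y j + a) / br (y i - y j + b) else 1) := by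
  have h1 := hy.sfac_left_ne_zero i j (n i)
  have h2 : br (y j - Y i - b) ≠ 0 := by
    refine hy.ne_zero j i (1 - n i) (-1) (fun _ => Or.inr (by norm_num)) ?_
    rw [hY]; push_cast; ring
  have h3 := hy.sfac_left_ne_zero i j (ν i)
  by_cases hi : i ∈ I <;> by_cases hj : j ∈ I
  · simp only [hy', hn i, hi, hj, if_true, sub_zero, not_true, and_false, if_false] at h1 ⊢
    have e : y i - a * 1 + c - (y j - a * 1 + c) = y i - y j := by ring
    rw [e]
    field_simp
  · have hij : i ≠ j := by rintro rfl; exact hj hi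
    simp only [hn i, hi, if_true] at h1 ⊢
    have e : y' i - y' j = y i - y j - a := by
      rw [hy', hy', if_pos hi, if_neg hj]; ring
    have e2 : y j - Y i - b = -(y i - y j - a + b + (ν i : ℂ) * a) := by
      rw [hY, hn, if_pos hi]; ring
    have e3 : y j - Y i - b - (a - b) = -(y i - y j - a + a + (ν i : ℂ) * a) := by
      rw [hY, hn, if_pos hi]; ring
    have k1 := sfac_succ br a (y i - y j - a + b) (ν i)
    have k2 := sfac_succ br a (y i - y j - a + a) (ν i)
    rw [sfac_succ_left] at k1 k2
    have e4 : y i - y j - a + b + a = y i - y j + b := by ring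
    have e5 : y i - y j - a + a = y i - y j := by ring
    have e6 : y i - y j - (a - b) = y i - y j - a + b := by ring
    have h5 : br (y i - y j) ≠ 0 := hy.ne_zero i j 0 0 (fun h => absurd h hij) (by simp)
    have h6 : br (y i - y j + (ν i : ℂ) * a) ≠ 0 :=
      hy.ne_zero i j (ν i) 0 (fun h => absurd h hij) (by simp)
    have h7 : sfac br a (y i - y j) (ν i : ℤ) ≠ 0 := by
      intro h
      rw [e5, h, zero_mul] at k2
      exact mul_ne_zero h5 h1 k2
    simp only [hj, not_false_eq_true, and_true, if_true, if_false]
    rw [e3, e, e2, hb.odd, hb.odd, e5, e6]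
    rw [e2, hb.odd, neg_ne_zero] at h2
    rw [e4] at k1
    rw [e5] at k2
    generalize br (y i - y j - a + b + (ν i : ℂ) * a) = A at *
    generalize br (y i - y j + (ν i : ℂ) * a) = B at *
    generalize sfac br a (y i - y j - a + b) (ν i : ℤ) = C at *
    generalize sfac br a (y i - y j) (ν i : ℤ) = D at *
    rw [div_eq_iff h7]
    field_simp
    linear_combination (-sfac br a (y i - y j + a) (ν i : ℤ) * br (y i - y j)) * k1
      + br (y i - y j - a + b) * sfac br a (y i - y j + b) (ν i : ℤ) * k2
  · have hij : i ≠ j := by rintro rfl; exact hi hj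
    simp only [hn i, hi, if_false] at h1 ⊢
    have e : y' i - y' j = y i - y j + a := by
      rw [hy', hy', if_neg hi, if_pos hj]; ring
    have e4 : y i - y j + a + b = y i - y j + b + a := by ring
    simp only [hj, if_true, sub_zero, not_true, not_false_eq_true, and_self, if_false]
    rw [e, sfac_succ_left, sfac_succ_left, e4]
    rw [sfac_succ_left] at h1
    have h5 := left_ne_zero_of_mul h1
    have h6 := right_ne_zero_of_mul h1
    have h7 : br (y i - y j + b) ≠ 0 := hy.ne_zero i j 0 1 (fun h => absurd h hij) (by simp)
    field_simp
  · simp only [hn i, hi, if_false] at h1 ⊢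
    have e : y' i - y' j = y i - y j := by
      rw [hy', hy', if_neg hi, if_neg hj]; ring
    have e2 : y j - Y i - b = -(y i - y j + b + (ν i : ℂ) * a) := by
      rw [hY, hn, if_neg hi]; push_cast; ring
    have e3 : y j - Y i - b - (a - b) = -(y i - y j + a + (ν i : ℂ) * a) := by
      rw [hY, hn, if_neg hi]; push_cast; ring
    simp only [hj, false_and, if_false, mul_one]
    rw [e3, e, e2, hb.odd, hb.odd, sfac_succ, sfac_succ]
    rw [e2, hb.odd, neg_ne_zero] at h2
    rw [sfac_succ] at h1
    have h6 := right_ne_zero_of_mul h1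
    generalize br (y i - y j + b + (ν i : ℂ) * a) = A at *
    generalize br (y i - y j + a + (ν i : ℂ) * a) = B at *
    field_simp

theorem block_backward (hb : IsBracket br) {m : ℕ} {a b : ℂ} {y : Fin m → ℂ}
    (hy : Spread br a b y)
    (ν n : Fin m → ℕ) (I : Finset (Fin m)) (hn : ∀ i, n i = if i ∈ I then ν i else ν i + 1)
    (Y y' : Fin m → ℂ) (hY : ∀ i, Y i = y i + a * (n i - 1)) (c : ℂ)
    (hy' : ∀ i, y' i = y i - a * (if i ∈ I then 1 else 0) + c) :
    (∏ i ∈ I, ∏ j ∈ Iᶜ, br (y i - y j - b) / br (y i - y j))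
      * (∏ i, ∏ j, if i < j then br (y' i - y' j + ((ν i : ℂ) - (ν j : ℂ)) * a) /
          br (y' i - y' j) else 1)
      * (∏ i, ∏ j, sfac br a (y' i - y' j + b) (ν i : ℤ) / sfac br a (y' i - y' j + a) (ν i : ℤ))
    = (∏ i, ∏ j, if i < j then br (Y i - Y j) / br (y i - y j) else 1)
      * (∏ i, ∏ j, sfac br a (y i - y j + b) (n i : ℤ) /
          (sfac br a (y i - y j + a) (n i : ℤ) * br (y j - Y i - b)))
      * ((∏ i ∈ I, ∏ j ∈ Iᶜ, br (y i - y j - (a - b)) / br (y i - y j))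
        * ∏ i, ∏ j, br (y j - Y i - b - if j ∈ I then 0 else a - b)) := by
  simp only [hb.sfac_ratio_backward hy ν n I hn Y y' hY c hy']
  simp only [prod_mul_distrib]
  rw [prod_offDiag_eq_prod_lt (fun i j => if i ∈ I ∧ j ∉ I then br (y i - y j - (a - b)) /
      br (y i - y j) else if j ∈ I ∧ i ∉ I then br (y i - y j + a) / br (y i - y j + b) else 1)
      (fun i => by simp)]
  rw [prod_compl_eq_prod_lt, prod_compl_eq_prod_lt]
  have hV : ∀ i j : Fin m, i < j →
      (((if i ∈ I ∧ j ∉ I then br (y i - y j - b) / br (y i - y j) else 1) *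
        (if j ∈ I ∧ i ∉ I then br (y j - y i - b) / br (y j - y i) else 1)) *
      (br (y' i - y' j + ((ν i : ℂ) - (ν j : ℂ)) * a) / br (y' i - y' j))) *
      ((if i ∈ I ∧ j ∉ I then br (y i - y j - (a - b)) / br (y i - y j)
          else if j ∈ I ∧ i ∉ I then br (y i - y j + a) / br (y i - y j + b) else 1) *
       (if j ∈ I ∧ i ∉ I then br (y j - y i - (a - b)) / br (y j - y i)
          else if i ∈ I ∧ j ∉ I then br (y j - y i + a) / br (y j - y i + b) else 1))
      = (br (Y i - Y j) / br (y i - y j)) *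
        ((if i ∈ I ∧ j ∉ I then br (y i - y j - (a - b)) / br (y i - y j) else 1) *
        (if j ∈ I ∧ i ∉ I then br (y j - y i - (a - b)) / br (y j - y i) else 1)) := by
    intro i j hij
    have hne : ∀ (i j : Fin m), i ≠ j → ∀ p q : ℤ, br (y i - y j + (p * a + q * b)) ≠ 0 :=
      fun i j h p q => hy i j p q fun h' => absurd h' h
    have e1 : br (y j - y i) = -br (y i - y j) := hb.swap _ _
    have e2 : br (y j - y i + a) = -br (y i - y j - a) := by rw [← hb.odd]; congr 1; ring
    have e3 : br (y j - y i + b) = -br (y i - y j - b) := by rw [← hb.odd]; congr 1; ring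
    have e4 : br (y j - y i - b) = -br (y i - y j + b) := by rw [← hb.odd]; congr 1; ring
    have e5 : br (y j - y i - (a - b)) = -br (y i - y j + (a - b)) := by
      rw [← hb.odd]; congr 1; ring
    have n1 : br (y i - y j) ≠ 0 := by simpa using hne i j hij.ne 0 0
    have n2 : br (y i - y j - a) ≠ 0 := by simpa [sub_eq_add_neg] using hne i j hij.ne (-1) 0
    have n3 : br (y i - y j - b) ≠ 0 := by simpa [sub_eq_add_neg] using hne i j hij.ne 0 (-1)
    have n4 : br (y i - y j + b) ≠ 0 := by simpa using hne i j hij.ne 0 1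
    have n5 : br (y i - y j + a) ≠ 0 := by simpa using hne i j hij.ne 1 0
    rw [e1, e2, e3, e4, e5]
    have hYY : y' i - y' j + ((ν i : ℂ) - ν j) * a = Y i - Y j := by
      rw [hY, hY, hy', hy', hn i, hn j]
      split_ifs <;> push_cast <;> ring
    rw [hYY]
    by_cases hi : i ∈ I <;> by_cases hj : j ∈ I <;>
      simp only [hi, hj, if_true, if_false, and_true, and_false, not_true, not_false_eq_true,
        mul_one, one_mul]
    · congr 2; rw [hy', hy', if_pos hi, if_pos hj]; ring
    · have e : y' i - y' j = y i - y j - a := by rw [hy', hy', if_pos hi, if_neg hj]; ring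
      rw [e]
      field_simp
    · have e : y' i - y' j = y i - y j + a := by rw [hy', hy', if_neg hi, if_pos hj]; ring
      rw [e]
      field_simp
    · congr 2; rw [hy', hy', if_neg hi, if_neg hj]; ring
  have hP := prod_congr (rfl : (univ : Finset (Fin m)) = univ) fun i _ =>
    prod_congr (rfl : (univ : Finset (Fin m)) = univ) fun j _ =>
      show (if i < j then _ else (1 : ℂ)) = if i < j then _ else 1 from by
        split_ifs with hij
        · exact hV i j hij
        · rfl
  have hsplit : ∀ (p : Fin m → Fin m → ℂ) (q : Fin m → Fin m → ℂ),
      (∏ i, ∏ j, if i < j then p i j * q i j else 1)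
        = (∏ i, ∏ j, if i < j then p i j else 1) * ∏ i, ∏ j, if i < j then q i j else 1 := by
    intro p q
    simp only [← prod_mul_distrib]
    refine prod_congr rfl fun i _ => prod_congr rfl fun j _ => ?_
    split_ifs <;> simp
  simp only [hsplit] at hP ⊢
  linear_combination (∏ i, ∏ j, sfac br a (y i - y j + b) (n i : ℤ) /
          (sfac br a (y i - y j + a) (n i : ℤ) * br (y j - Y i - b)))
    * (∏ i, ∏ j, br (y j - Y i - b - if j ∈ I then 0 else a - b)) * hP
end IsBracket

theorem sourceTerm_disjSum {m r : ℕ} (br : ℂ → ℂ) (t : ℂ) (X p : Fin m → ℂ) (y W : Fin r → ℂ)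
    (J : Finset (Fin m)) (I : Finset (Fin r)) :
    sourceTerm br t (Sum.elim X y) (Sum.elim p W) (J.disjSum I) =
      ((∏ i ∈ J, ∏ j ∈ Jᶜ, br (X i - X j - t) / br (X i - X j)) *
        ∏ i, ∏ j, br (X i - p j - if i ∈ J then 0 else t)) *
      ((∏ i ∈ I, ∏ j ∈ Iᶜ, br (y i - y j - t) / br (y i - y j)) *
        ∏ i, ∏ j, br (y j - W i - if j ∈ I then 0 else t)) *
      ∏ i, ∏ j, (br (X i - W j - if i ∈ J then 0 else t) * br (y j - p i - if j ∈ I then 0 else t)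
        * ((if i ∈ J ∧ j ∉ I then br (X i - y j - t) / br (X i - y j) else 1)
          * if j ∈ I ∧ i ∉ J then br (y j - X i - t) / br (y j - X i) else 1)) := by
  simp only [sourceTerm, prod_compl_eq_prod_ite, Fintype.prod_sum_type, Sum.elim_inl,
    Sum.elim_inr, inl_mem_disjSum, inr_mem_disjSum, prod_mul_distrib]
  rw [prod_comm (f := fun (i : Fin m) (j : Fin r) =>
      br (y j - p i - if j ∈ I then (0 : ℂ) else t)),
    prod_comm (f := fun (i : Fin m) (j : Fin r) =>
      if j ∈ I ∧ i ∉ J then br (y j - X i - t) / br (y j - X i) else 1),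
    prod_comm (f := fun i j : Fin r => br (y j - W i - if j ∈ I then (0 : ℂ) else t))]
  ring

namespace IsBracket
variable {br : ℂ → ℂ}

theorem prod_compl_flip (hb : IsBracket br) {m : ℕ} (z : Fin m → ℂ) (c : ℂ) (K : Finset (Fin m)) :
    ∏ i ∈ Kᶜ, ∏ j ∈ Kᶜᶜ, br (z i - z j + c) / br (z i - z j)
      = ∏ i ∈ K, ∏ j ∈ Kᶜ, br (z i - z j - c) / br (z i - z j) := by
  rw [compl_compl, Finset.prod_comm]
  refine prod_congr rfl fun i _ => prod_congr rfl fun j _ => ?_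
  have e : z j - z i + c = -(z i - z j - c) := by ring
  rw [hb.swap (z j), e, hb.odd, neg_div_neg_eq]

section
variable {δ κ x y X W : ℂ} (μ ν : ℕ) (P Q : Prop) [Decidable P] [Decidable Q]

/-- The mixed factors of a product of coefficients shifting in opposite directions. -/
theorem mixed_opposite (hb : IsBracket br) (h : ∀ p q : ℤ, br (x - y + (p * δ + q * κ)) ≠ 0)
    (hX : X = x + δ * ((if Q then μ else μ + 1 : ℕ) - 1))
    (hW : W = y + κ * ((if P then ν else ν + 1 : ℕ) - 1) + δ) :
    (if P then br (x - y - κ) / br (x - y + (μ : ℂ) * δ)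
      else br (x - y - δ) / br (x - y + ((μ : ℂ) - 1) * δ)) *
    (if Q then br (y - κ * (if P then 1 else 0) + κ - (x + δ * μ - δ) - δ) /
        br (y - κ * (if P then 1 else 0) + κ - (x + δ * μ - δ) + (ν : ℂ) * κ)
      else br (y - κ * (if P then 1 else 0) + κ - (x + δ * μ - δ) - κ) /
        br (y - κ * (if P then 1 else 0) + κ - (x + δ * μ - δ) + ((ν : ℂ) - 1) * κ))
    = -1 / (br (X - W) * br (X - W - (κ - δ))) *
      (br (X - W - if Q then 0 else κ - δ) * br (y - (x - κ) - if P then 0 else κ - δ) *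
      ((if Q ∧ ¬ P then br (X - y - (κ - δ)) / br (X - y) else 1) *
        if P ∧ ¬ Q then br (y - X - (κ - δ)) / br (y - X) else 1)) := by
  have n1 : br (X - W) ≠ 0 := by
    convert h ((if Q then μ else μ + 1 : ℕ) - 2) (1 - (if P then ν else ν + 1 : ℕ)) using 2
    rw [hX, hW]; push_cast; ring
  have n2 : br (X - W - (κ - δ)) ≠ 0 := by
    convert h ((if Q then μ else μ + 1 : ℕ) - 1) (-(if P then ν else ν + 1 : ℕ)) using 2
    rw [hX, hW]; push_cast; ring
  have n3 : br (x - y + (μ : ℂ) * δ) ≠ 0 := by simpa using h μ 0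
  have n4 : br (x - y + ((μ : ℂ) - 1) * δ) ≠ 0 := by simpa using h (μ - 1) 0
  by_cases hP : P <;> by_cases hQ : Q <;>
    simp only [hP, hQ, if_true, if_false, not_true, not_false_eq_true, and_true, and_false,
      and_self, mul_one, one_mul, sub_zero] at hX hW ⊢
  · have e1 : br (y - κ + κ - (x + δ * μ - δ) - δ) = -br (x - y + (μ : ℂ) * δ) := by
      rw [← hb.odd]; congr 1; ring
    have e2 : br (y - κ + κ - (x + δ * μ - δ) + (ν : ℂ) * κ) = -br (X - W - (κ - δ)) := by
      rw [← hb.odd]; congr 1; rw [hX, hW]; ring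
    have e3 : br (y - (x - κ)) = -br (x - y - κ) := by rw [← hb.odd]; congr 1; ring
    rw [e1, e2, e3]
    generalize br (x - y + (μ : ℂ) * δ) = A at *
    field_simp
  · push_cast at hX
    have e1 : br (y - κ + κ - (x + δ * μ - δ) - κ) = br (y - X - (κ - δ)) := by
      congr 1; rw [hX]; ring
    have e2 : br (y - κ + κ - (x + δ * μ - δ) + ((ν : ℂ) - 1) * κ) = -br (X - W) := by
      rw [← hb.odd]; congr 1; rw [hX, hW]; ring
    have e3 : br (y - (x - κ)) = -br (x - y - κ) := by rw [← hb.odd]; congr 1; ring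
    have e4 : br (y - X) = -br (x - y + (μ : ℂ) * δ) := by
      rw [← hb.odd]; congr 1; rw [hX]; ring
    rw [e1, e2, e3, e4]
    generalize br (x - y + (μ : ℂ) * δ) = A at *
    field_simp
  · push_cast at hW
    have e1 : br (y - κ * 0 + κ - (x + δ * μ - δ) - δ) = -br (X - y - (κ - δ)) := by
      rw [← hb.odd]; congr 1; rw [hX]; ring
    have e2 : br (y - κ * 0 + κ - (x + δ * μ - δ) + (ν : ℂ) * κ) = -br (X - W - (κ - δ)) := by
      rw [← hb.odd]; congr 1; rw [hX, hW]; ring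
    have e3 : br (y - (x - κ) - (κ - δ)) = -br (x - y - δ) := by rw [← hb.odd]; congr 1; ring
    have e4 : br (X - y) = br (x - y + ((μ : ℂ) - 1) * δ) := by
      congr 1; rw [hX]; ring
    rw [e1, e2, e3, e4]
    generalize br (x - y + ((μ : ℂ) - 1) * δ) = A at *
    field_simp
  · push_cast at hW hX
    have e1 : br (y - κ * 0 + κ - (x + δ * μ - δ) - κ) = -br (x - y + ((μ : ℂ) - 1) * δ) := by
      rw [← hb.odd]; congr 1; ring
    have e2 : br (y - κ * 0 + κ - (x + δ * μ - δ) + ((ν : ℂ) - 1) * κ) = -br (X - W) := by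
      rw [← hb.odd]; congr 1; rw [hX, hW]; ring
    have e3 : br (y - (x - κ) - (κ - δ)) = -br (x - y - δ) := by rw [← hb.odd]; congr 1; ring
    rw [e1, e2, e3]
    generalize br (x - y + ((μ : ℂ) - 1) * δ) = A at *
    field_simp

/-- The mixed factors of a product of coefficients shifting in the same direction. -/
theorem mixed_parallel (hb : IsBracket br) (h : ∀ p q : ℤ, br (x - y + (p * δ + q * κ)) ≠ 0)
    (hX : X = x + δ * ((if Q then μ else μ + 1 : ℕ) - 1))
    (hW : W = y - κ * (if P then ν + 1 else ν : ℕ)) :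
    (if P then br (x - y - κ) / br (x - y + (μ : ℂ) * δ)
      else br (x - y - δ) / br (x - y + ((μ : ℂ) - 1) * δ)) *
    (if Q then br (y - κ * (if P then 1 else 0) - (x + δ * μ) + κ) /
        br (y - κ * (if P then 1 else 0) - (x + δ * μ) - ((ν : ℂ) - 1) * κ)
      else br (y - κ * (if P then 1 else 0) - (x + δ * μ) + δ) /
        br (y - κ * (if P then 1 else 0) - (x + δ * μ) - (ν : ℂ) * κ))
    = -1 / (br (X - W) * br (X - W - (κ - δ))) *
      (br (X - W - if Q then 0 else κ - δ) * br (y - (x - κ) - if P then 0 else κ - δ) *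
      ((if Q ∧ ¬ P then br (X - y - (κ - δ)) / br (X - y) else 1) *
        if P ∧ ¬ Q then br (y - X - (κ - δ)) / br (y - X) else 1)) := by
  have n1 : br (X - W) ≠ 0 := by
    convert h ((if Q then μ else μ + 1 : ℕ) - 1) (if P then ν + 1 else ν : ℕ) using 2
    rw [hX, hW]; push_cast; ring
  have n2 : br (X - W - (κ - δ)) ≠ 0 := by
    convert h ((if Q then μ else μ + 1 : ℕ)) ((if P then ν + 1 else ν : ℕ) - 1) using 2
    rw [hX, hW]; push_cast; ring
  have n3 : br (x - y + (μ : ℂ) * δ) ≠ 0 := by simpa using h μ 0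
  have n4 : br (x - y + ((μ : ℂ) - 1) * δ) ≠ 0 := by simpa using h (μ - 1) 0
  by_cases hP : P <;> by_cases hQ : Q <;>
    simp only [hP, hQ, if_true, if_false, not_true, not_false_eq_true, and_true, and_false,
      and_self, mul_one, one_mul, sub_zero] at hX hW ⊢
  · push_cast at hW
    have e1 : br (y - κ - (x + δ * μ) + κ) = -br (x - y + (μ : ℂ) * δ) := by
      rw [← hb.odd]; congr 1; ring
    have e2 : br (y - κ - (x + δ * μ) - ((ν : ℂ) - 1) * κ) = -br (X - W - (κ - δ)) := by
      rw [← hb.odd]; congr 1; rw [hX, hW]; ring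
    have e3 : br (y - (x - κ)) = -br (x - y - κ) := by rw [← hb.odd]; congr 1; ring
    rw [e1, e2, e3]
    generalize br (x - y + (μ : ℂ) * δ) = A at *
    field_simp
  · push_cast at hX hW
    have e1 : br (y - κ - (x + δ * μ) + δ) = br (y - X - (κ - δ)) := by
      congr 1; rw [hX]; ring
    have e2 : br (y - κ - (x + δ * μ) - (ν : ℂ) * κ) = -br (X - W) := by
      rw [← hb.odd]; congr 1; rw [hX, hW]; ring
    have e3 : br (y - (x - κ)) = -br (x - y - κ) := by rw [← hb.odd]; congr 1; ring
    have e4 : br (y - X) = -br (x - y + (μ : ℂ) * δ) := by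
      rw [← hb.odd]; congr 1; rw [hX]; ring
    rw [e1, e2, e3, e4]
    generalize br (x - y + (μ : ℂ) * δ) = A at *
    field_simp
  · have e1 : br (y - κ * 0 - (x + δ * μ) + κ) = -br (X - y - (κ - δ)) := by
      rw [← hb.odd]; congr 1; rw [hX]; ring
    have e2 : br (y - κ * 0 - (x + δ * μ) - ((ν : ℂ) - 1) * κ) = -br (X - W - (κ - δ)) := by
      rw [← hb.odd]; congr 1; rw [hX, hW]; ring
    have e3 : br (y - (x - κ) - (κ - δ)) = -br (x - y - δ) := by rw [← hb.odd]; congr 1; ring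
    have e4 : br (X - y) = br (x - y + ((μ : ℂ) - 1) * δ) := by
      congr 1; rw [hX]; ring
    rw [e1, e2, e3, e4]
    generalize br (x - y + ((μ : ℂ) - 1) * δ) = A at *
    field_simp
  · push_cast at hW hX
    have e1 : br (y - κ * 0 - (x + δ * μ) + δ) = -br (x - y + ((μ : ℂ) - 1) * δ) := by
      rw [← hb.odd]; congr 1; ring
    have e2 : br (y - κ * 0 - (x + δ * μ) - (ν : ℂ) * κ) = -br (X - W) := by
      rw [← hb.odd]; congr 1; rw [hX, hW]; ring
    have e3 : br (y - (x - κ) - (κ - δ)) = -br (x - y - δ) := by rw [← hb.odd]; congr 1; ring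
    rw [e1, e2, e3]
    generalize br (x - y + ((μ : ℂ) - 1) * δ) = A at *
    field_simp
end
end IsBracket

theorem prod_mul_prod_compl_eq_prod_ite {ι : Type*} [Fintype ι] [DecidableEq ι] (I : Finset ι)
    (f g : ι → ℂ) : (∏ j ∈ I, f j) * ∏ j ∈ Iᶜ, g j = ∏ j, if j ∈ I then f j else g j := by
  rw [← prod_mul_prod_compl I (fun j => if j ∈ I then f j else g j)]
  congr 1
  · exact prod_congr rfl fun j hj => (if_pos hj).symm
  · exact prod_congr rfl fun j hj => (if_neg (mem_compl.1 hj)).symm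

/-- All brackets of differences of coordinates and of zero, shifted by integer combinations of
`δ` and `κ`, are nonzero, apart from the bracket of zero. -/
structure Generic (br : ℂ → ℂ) (δ κ : ℂ) {m r : ℕ} (x : Fin m → ℂ) (y : Fin r → ℂ) : Prop where
  left : Spread br δ κ x
  right : Spread br κ δ y
  cross : ∀ i j (p q : ℤ), br (x i - y j + (p * δ + q * κ)) ≠ 0
  lattice : ∀ p q : ℤ, p ≠ 0 ∨ q ≠ 0 → br (p * δ + q * κ) ≠ 0

/-- The part of the coefficient of a shift of `x` by `a n` that depends on `x` only. -/
noncomputable def shiftWeight (br : ℂ → ℂ) (a b : ℂ) {m : ℕ} (n : Fin m → ℕ) (x : Fin m → ℂ) : ℂ :=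
  (∏ i, ∏ j, if i < j then br (x i + a * n i - (x j + a * n j)) / br (x i - x j) else 1) *
    ∏ i, ∏ j, sfac br a (x i - x j + b) (n i : ℤ) / sfac br a (x i - x j + a) (n i : ℤ)

theorem shiftWeight_add_const (br : ℂ → ℂ) (a b : ℂ) {m : ℕ} (n : Fin m → ℕ) (x : Fin m → ℂ)
    (c : ℂ) : shiftWeight br a b n (fun i => x i + c) = shiftWeight br a b n x := by
  have e : ∀ i j, x i + c + a * n i - (x j + c + a * n j) = x i + a * n i - (x j + a * n j) :=
    fun i j => by ring
  simp only [shiftWeight, e, add_sub_add_right_eq_sub]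

/-- The part of the coefficients of a fixed total shift, for a pair of operators, that depends on
both sets of variables. -/
noncomputable def pairFactor (br : ℂ → ℂ) (t s : ℂ) {m r : ℕ} (X p : Fin m → ℂ) (y W : Fin r → ℂ) :
    ℂ :=
  (∏ i, ∏ j, (br (X i - p j))⁻¹) * (∏ i, ∏ j, (br (y j - W i - s))⁻¹) *
    ∏ i, ∏ j, -1 / (br (X i - W j) * br (X i - W j - t))

theorem sourceTerm_add_const {ι : Type*} [Fintype ι] [DecidableEq ι] (br : ℂ → ℂ) (t : ℂ)
    (z w : ι → ℂ) (c : ℂ) (K : Finset ι) :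
    sourceTerm br t (fun i => z i + c) (fun i => w i + c) K = sourceTerm br t z w K := by
  simp only [sourceTerm, add_sub_add_right_eq_sub]

theorem prod_shiftWeight (br : ℂ → ℂ) (a b : ℂ) {m : ℕ} (n : Fin m → ℕ) (x X : Fin m → ℂ) (c : ℂ)
    (hX : ∀ i, X i = x i + a * n i + c) (d : Fin m → Fin m → ℂ) :
    (∏ i, ∏ j, if i < j then br (X i - X j) / br (x i - x j) else 1) *
        (∏ i, ∏ j, sfac br a (x i - x j + b) (n i : ℤ) /
          (sfac br a (x i - x j + a) (n i : ℤ) * d i j))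
      = shiftWeight br a b n x * ∏ i, ∏ j, (d i j)⁻¹ := by
  have e : ∀ i j, X i - X j = x i + a * n i - (x j + a * n j) := fun i j => by
    rw [hX, hX]; ring
  simp only [shiftWeight, e, ← div_div, div_eq_mul_inv _ (d _ _), prod_mul_distrib, mul_assoc]

theorem mul_mul_eq_of_regroup {A P S M A' P' S' M' R R' R'' : ℂ} (e e' : ℂ)
    (h : A * S * P' = R) (h' : P * A' * S' = R') (h'' : M * M' = R'') :
    (e * A * P * S * M) * (e' * A' * P' * S' * M') = e * e' * (R * R' * R'') := by
  rw [← h, ← h', ← h'']; ring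

namespace IsBracket
variable {br : ℂ → ℂ} {δ κ : ℂ} {m r : ℕ} {x : Fin m → ℂ} {y : Fin r → ℂ}

/-- The product of two coefficients of operators shifting in opposite directions. -/
theorem coef_mul_coef_opposite (hb : IsBracket br) (h : Generic br δ κ x y)
    (μ n : Fin m → ℕ) (ν l : Fin r → ℕ) (I : Finset (Fin r)) (J : Finset (Fin m))
    (hn : ∀ i, n i = if i ∈ J then μ i else μ i + 1)
    (hl : ∀ j, l j = if j ∈ I then ν j else ν j + 1)
    (X : Fin m → ℂ) (hX : ∀ i, X i = x i + δ * (n i - 1))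
    (W : Fin r → ℂ) (hW : ∀ j, W j = y j + κ * (l j - 1) + δ) :
    Coef br δ κ μ I x y * Coef br κ δ ν J (fun j => yshift κ I y j + κ)
        (fun i => xshift δ μ x i - δ)
      = (-1) ^ (I.card + J.card) *
        (shiftWeight br δ κ n x * shiftWeight br κ δ l y *
          pairFactor br (κ - δ) 0 X (fun i => x i - κ) y W) *
        sourceTerm br (κ - δ) (Sum.elim X y) (Sum.elim (fun i => x i - κ) W) (J.disjSum I) := by
  have B1 := hb.block_forward h.left μ n J hn X hX
  have B2 := hb.block_backward h.right ν l I hl (fun j => W j - δ)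
    (fun j => yshift κ I y j + κ) (fun j => by simp only [hW]; ring) κ (fun j => rfl)
  have B3 := prod_congr rfl fun i (_ : i ∈ univ) => prod_congr rfl fun j (_ : j ∈ univ) =>
    hb.mixed_opposite (μ i) (ν j) (j ∈ I) (i ∈ J) (h.cross i j) (X := X i) (W := W j)
      (by rw [hX, hn]) (by rw [hW, hl])
  simp only [Coef, prod_mul_prod_compl_eq_prod_ite, sourceTerm_disjSum]
  rw [prod_shiftWeight br δ κ n x X (-δ) (fun i => by rw [hX]; ring)] at B1
  rw [prod_shiftWeight br κ δ l y _ (-κ) (fun j => by rw [hW]; ring)] at B2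
  have e1 : ∀ i j, X i - (x j - κ) = X i - x j + κ := fun i j => by ring
  have e2 : ∀ i j, y j - (W i - δ) - δ = y j - W i := fun i j => by ring
  simp only [prod_mul_distrib] at B3
  rw [Finset.prod_comm (s := univ) (t := univ) (f := fun (i : Fin m) (j : Fin r) =>
    if i ∈ J then _ else _)] at B3
  simp only [xshift, sub_sub_sub_cancel_right]
  refine (mul_mul_eq_of_regroup _ _ B1 B2 B3).trans ?_
  simp only [pairFactor, e1, e2, sub_zero, prod_mul_distrib, pow_add]
  ring

/-- The product of two coefficients of operators shifting in the same direction. -/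
theorem coef_mul_coef_parallel (hb : IsBracket br) (h : Generic br δ κ x y)
    (μ n : Fin m → ℕ) (ν l : Fin r → ℕ) (I : Finset (Fin r)) (J : Finset (Fin m))
    (hn : ∀ i, n i = if i ∈ J then μ i + 1 else μ i)
    (hl : ∀ j, l j = if j ∈ I then ν j + 1 else ν j)
    (X : Fin m → ℂ) (hX : ∀ i, X i = x i + δ * (n i - 1))
    (W : Fin r → ℂ) (hW : ∀ j, W j = y j - κ * l j) :
    Coef br δ κ μ I x y * Coef br (-κ) (-δ) ν J (yshift κ I y) (xshift δ μ x)
      = (-1) ^ (I.card + J.card) *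
        (shiftWeight br δ κ n x * shiftWeight br (-κ) (-δ) l y *
          pairFactor br (κ - δ) (κ - δ) X (fun i => x i - κ) y W) *
        sourceTerm br (κ - δ) (Sum.elim X y) (Sum.elim (fun i => x i - κ) W) (Jᶜ.disjSum I) := by
  have hy : Spread br (-κ) (-δ) (fun j => y j - κ) := fun i j p q hpq =>
    h.right.ne_zero i j (-p) (-q) (fun e => by simpa using hpq e) (by push_cast; ring)
  have B1 := hb.block_forward h.left μ n Jᶜ (fun i => by simp only [hn, mem_compl, ite_not]) X hX
  have B2 := hb.block_backward hy ν l Iᶜ (fun i => by simp only [hl, mem_compl, ite_not]) W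
    (yshift κ I y) (fun j => by rw [hW]; ring) 0
    (fun j => by by_cases hj : j ∈ I <;> simp [yshift, hj])
  have B3 := prod_congr rfl fun i (_ : i ∈ univ) => prod_congr rfl fun j (_ : j ∈ univ) =>
    hb.mixed_parallel (μ i) (ν j) (j ∈ I) (i ∈ Jᶜ) (h.cross i j) (X := X i) (W := W j)
      (by rw [hX, hn]; simp only [mem_compl, ite_not]) (by rw [hW, hl])
  rw [prod_shiftWeight br δ κ n x X (-δ) (fun i => by rw [hX]; ring)] at B1
  rw [prod_shiftWeight br (-κ) (-δ) l _ _ κ (fun j => by rw [hW]; ring),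
    show (fun j => y j - κ) = fun j => y j + -κ from funext fun j => sub_eq_add_neg _ _,
    shiftWeight_add_const] at B2
  have e1 : ∀ i j, X i - (x j - κ) = X i - x j + κ := fun i j => by ring
  have e2 : ∀ i j, y j - W i - (κ - δ) = y j - κ - W i + δ := fun i j => by ring
  have e3 : ∀ i j, br (y j - κ - W i + δ - if j ∈ I then -κ + δ else 0)
      = br (y j - W i - if j ∈ I then 0 else κ - δ) := fun i j => by
    by_cases hj : j ∈ I <;> simp only [hj, if_true, if_false] <;> congr 1 <;> ring
  have e4 : ∀ i j : Fin r, br (y i - y j - (-κ + δ)) = br (y i - y j + (κ - δ)) :=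
    fun i j => by congr 1; ring
  have f1 := hb.prod_compl_flip (fun i => x i + δ * μ i) (-κ) J
  have f2 := hb.prod_compl_flip y δ I
  have f3 := hb.prod_compl_flip y (κ - δ) I
  simp only [prod_mul_distrib] at B3
  rw [Finset.prod_comm (s := univ) (t := univ) (f := fun (i : Fin m) (j : Fin r) =>
    if i ∈ Jᶜ then _ else _)] at B3
  simp only [Coef, prod_mul_prod_compl_eq_prod_ite, sourceTerm_disjSum]
  simp only [xshift, yshift, mem_compl, ite_not, not_not, sub_neg_eq_add, mul_neg,
    ← sub_eq_add_neg, sub_sub_sub_cancel_right] at f1 B1 B2 B3 ⊢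
  rw [f1] at B1
  simp only [e3, e4] at B2
  rw [f2, f3] at B2
  refine (mul_mul_eq_of_regroup _ _ B1 B2 B3).trans ?_
  simp only [pairFactor, e1, e2, prod_mul_distrib, pow_add]
  ring
end IsBracket

namespace Generic
variable {br : ℂ → ℂ} {δ κ : ℂ} {m r : ℕ} {x : Fin m → ℂ} {y : Fin r → ℂ}

theorem swap (hb : IsBracket br) (h : Generic br δ κ x y) : Generic br κ δ y x where
  left := h.right
  right := h.left
  cross i j p q := by
    have := h.cross j i (-q) (-p)
    contrapose! this
    rw [← neg_eq_zero, ← hb.odd]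
    convert this using 2
    push_cast; ring
  lattice p q hpq := by rw [add_comm]; exact h.lattice q p hpq.symm

theorem neg (h : Generic br δ κ x y) : Generic br (-δ) (-κ) x y where
  left i j p q hpq := h.left.ne_zero i j (-p) (-q) (fun e => by simpa using hpq e)
    (by push_cast; ring)
  right i j p q hpq := h.right.ne_zero i j (-p) (-q) (fun e => by simpa using hpq e)
    (by push_cast; ring)
  cross i j p q := by convert h.cross i j (-p) (-q) using 2; push_cast; ring
  lattice p q hpq := by
    convert h.lattice (-p) (-q) (by simpa using hpq) using 2; push_cast; ring

theorem shift (h : Generic br δ κ x y) (a b : Fin m → ℤ) (c d : Fin r → ℤ) {x' : Fin m → ℂ}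
    {y' : Fin r → ℂ} (hx : ∀ i, x' i = x i + (a i * δ + b i * κ))
    (hy : ∀ j, y' j = y j + (c j * δ + d j * κ)) : Generic br δ κ x' y' where
  left i j p q hpq := h.left.ne_zero i j (p + a i - a j) (q + b i - b j)
    (fun e => by subst e; simpa using hpq rfl) (by rw [hx, hx]; push_cast; ring)
  right i j p q hpq := h.right.ne_zero i j (p + d i - d j) (q + c i - c j)
    (fun e => by subst e; simpa using hpq rfl) (by rw [hy, hy]; push_cast; ring)
  cross i j p q := by
    convert h.cross i j (p + a i - c j) (q + b i - d j) using 2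
    rw [hx, hy]; push_cast; ring
  lattice := h.lattice
end Generic

section
variable {ι : Type*} [Fintype ι] [DecidableEq ι] (br : ℂ → ℂ) (t : ℂ)

theorem sourceTerm_congr {t t' : ℂ} {z w z' w' : ι → ℂ} (K : Finset ι) (c : ℂ) (ht : t = t')
    (hz : ∀ i, z i = z' i + c) (hw : ∀ i, w i = w' i + c) :
    sourceTerm br t z w K = sourceTerm br t' z' w' K := by
  rw [← sourceTerm_add_const br t' z' w' c, ← ht, ← funext hz, ← funext hw]

theorem sourceTerm_sum_swap {m r : ℕ} (X p : Fin m → ℂ) (y W : Fin r → ℂ)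
    (J : Finset (Fin m)) (I : Finset (Fin r)) :
    sourceTerm br t (Sum.elim y X) (Sum.elim W p) (I.disjSum J)
      = sourceTerm br t (Sum.elim X y) (Sum.elim p W) (J.disjSum I) := by
  rw [← sourceTerm_map br t (Sum.elim X y) (Sum.elim p W) (Equiv.sumComm (Fin m) (Fin r))]
  congr 1
  · ext (i | i) <;> simp
  · ext (i | i) <;> simp
  · ext (i | i) <;> simp

variable {br} in
theorem IsBracket.sourceTerm_compl (hb : IsBracket br) (z w : ι → ℂ) (K : Finset ι) :
    sourceTerm br t z w Kᶜ = sourceTerm br (-t) (fun i => z i - t) w K := by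
  unfold sourceTerm
  congr 1
  · rw [compl_compl, Finset.prod_comm]
    refine prod_congr rfl fun i _ => prod_congr rfl fun j _ => ?_
    have e : z j - z i - t = -(z i - t - (z j - t) - -t) := by ring
    rw [hb.swap (z j), e, hb.odd, neg_div_neg_eq, sub_sub_sub_cancel_right]
  · refine prod_congr rfl fun i _ => prod_congr rfl fun j _ => ?_
    by_cases hi : i ∈ K <;> simp only [hi, mem_compl, not_true, not_false_eq_true, if_true,
      if_false] <;> congr 1 <;> ring
end

theorem disjSum_compl_compl {α β : Type*} [Fintype α] [Fintype β] [DecidableEq α] [DecidableEq β]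
    (A : Finset α) (B : Finset β) : Aᶜ.disjSum B = (A.disjSum Bᶜ)ᶜ := by
  ext (i | i) <;> simp

theorem prod_inv_of_neg {n : ℕ} {f g : Fin n → Fin n → ℂ} (h : ∀ i j, f i j = -g i j) :
    ∏ i, ∏ j, (f i j)⁻¹ = (-1) ^ n * ∏ i, ∏ j, (g i j)⁻¹ := by
  simp only [h, inv_neg, ← neg_one_mul (g _ _)⁻¹, prod_mul_distrib, prod_const, card_univ,
    Fintype.card_fin, ← pow_mul]
  congr 1
  rcases Nat.even_or_odd n with hn | hn
  · rw [hn.neg_one_pow, (hn.mul_right n).neg_one_pow]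
  · rw [hn.neg_one_pow, (hn.mul hn).neg_one_pow]

namespace IsBracket
variable {br : ℂ → ℂ} {δ κ : ℂ} {m r : ℕ} {x : Fin m → ℂ} {y : Fin r → ℂ}

theorem pairFactor_swap (hb : IsBracket br) {t s t' s' : ℂ} {X p X' p' : Fin m → ℂ}
    {y W y' W' : Fin r → ℂ} (h1 : ∀ i j, W' i - y' j = -(y j - W i - s))
    (h2 : ∀ i j, p' j - X' i - s' = -(X i - p j))
    (h3 : ∀ i j, W' j - X' i = -(X i - W j) ∧ W' j - X' i - t' = -(X i - W j - t)
      ∨ W' j - X' i = -(X i - W j - t) ∧ W' j - X' i - t' = -(X i - W j)) :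
    pairFactor br t' s' W' y' p' X' = (-1) ^ (m + r) * pairFactor br t s X p y W := by
  unfold pairFactor
  rw [prod_inv_of_neg (g := fun i j => br (y j - W i - s)) (fun i j => by rw [h1, hb.odd]),
    prod_inv_of_neg (g := fun i j => br (X i - p j)) (fun i j => by rw [h2, hb.odd]),
    Finset.prod_comm (s := univ) (t := univ)
    (f := fun (i : Fin r) (j : Fin m) => -1 / (br (W' i - X' j) * br (W' i - X' j - t')))]
  have : ∀ i j, -1 / (br (W' j - X' i) * br (W' j - X' i - t'))
      = -1 / (br (X i - W j) * br (X i - W j - t)) := fun i j => by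
    rcases h3 i j with ⟨ha, hc⟩ | ⟨ha, hc⟩ <;> rw [hc, ha, hb.odd, hb.odd]
    · ring
    · ring
  simp only [this, pow_add]
  ring

/-- The product in reverse order of two coefficients of operators shifting in opposite
directions. -/
theorem coef_mul_coef_opposite_rev (hb : IsBracket br) (h : Generic br δ κ x y)
    (μ n : Fin m → ℕ) (ν l : Fin r → ℕ) (I : Finset (Fin r)) (J : Finset (Fin m))
    (hn : ∀ i, n i = if i ∈ J then μ i else μ i + 1)
    (hl : ∀ j, l j = if j ∈ I then ν j else ν j + 1)
    (X : Fin m → ℂ) (hX : ∀ i, X i = x i + δ * (n i - 1))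
    (W : Fin r → ℂ) (hW : ∀ j, W j = y j + κ * (l j - 1) + δ) :
    Coef br κ δ ν J (fun j => y j + κ) (fun i => x i - δ) *
        Coef br δ κ μ I (xshiftI (-δ) J x) (yshiftMu (-κ) ν y)
      = (-1) ^ (I.card + J.card) * ((-1) ^ (m + r) *
        (shiftWeight br δ κ n x * shiftWeight br κ δ l y *
          pairFactor br (κ - δ) 0 X (fun i => x i - κ) y W)) *
        sourceTerm br (-(κ - δ)) (Sum.elim (fun i => x i - κ) W) (Sum.elim X y)
          (J.disjSum I) := by
  have h' : Generic br κ δ (fun j => y j + κ) (fun i => x i - δ) :=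
    (h.swap hb).shift (fun _ => 1) 0 0 (fun _ => -1) (fun i => by simp)
      (fun i => by simp [sub_eq_add_neg])
  have key := hb.coef_mul_coef_opposite h' ν l μ n J I hl hn (fun j => W j + (κ - δ))
    (fun j => by rw [hW]; ring) (fun i => X i + (κ - δ)) (fun i => by rw [hX]; ring)
  have e1 : (fun j => yshift δ J (fun i => x i - δ) j + δ) = xshiftI (-δ) J x := by
    ext i; simp only [yshift, xshiftI]; ring
  have e2 : (fun i => xshift κ ν (fun j => y j + κ) i - κ) = yshiftMu (-κ) ν y := by
    ext i; simp only [xshift, yshiftMu]; ring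
  rw [e1, e2] at key
  rw [key, shiftWeight_add_const, show (fun i => x i - δ) = fun i => x i + -δ from
    funext fun _ => sub_eq_add_neg _ _, shiftWeight_add_const,
    hb.pairFactor_swap (t := κ - δ) (s := 0) (X := X) (p := fun i => x i - κ) (y := y) (W := W)
      (fun i j => by ring) (fun i j => by ring)
      (fun i j => Or.inl ⟨by ring, by ring⟩), ← sourceTerm_sum_swap,
    sourceTerm_congr br _ (κ - δ) (neg_sub κ δ).symm (z' := Sum.elim (fun i => x i - κ) W)
      (w' := Sum.elim X y), add_comm J.card]
  · ring
  · rintro (i | i) <;> simp; ring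
  · rintro (i | i) <;> simp; ring

/-- The product in reverse order of two coefficients of operators shifting in the same
direction. -/
theorem coef_mul_coef_parallel_rev (hb : IsBracket br) (h : Generic br δ κ x y)
    (μ n : Fin m → ℕ) (ν l : Fin r → ℕ) (I : Finset (Fin r)) (J : Finset (Fin m))
    (hn : ∀ i, n i = if i ∈ J then μ i + 1 else μ i)
    (hl : ∀ j, l j = if j ∈ I then ν j + 1 else ν j)
    (X : Fin m → ℂ) (hX : ∀ i, X i = x i + δ * (n i - 1))
    (W : Fin r → ℂ) (hW : ∀ j, W j = y j - κ * l j) :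
    Coef br (-κ) (-δ) ν J y x * Coef br δ κ μ I (xshiftI δ J x) (yshiftMu κ ν y)
      = (-1) ^ (I.card + J.card) * ((-1) ^ (m + r) *
        (shiftWeight br δ κ n x * shiftWeight br (-κ) (-δ) l y *
          pairFactor br (κ - δ) (κ - δ) X (fun i => x i - κ) y W)) *
        sourceTerm br (-(κ - δ)) (Sum.elim (fun i => x i - κ) W) (Sum.elim X y)
          (Jᶜ.disjSum I) := by
  have key := hb.coef_mul_coef_parallel (h.swap hb).neg ν l μ n J I hl hn (fun j => W j + κ)
    (fun j => by rw [hW]; ring) (fun i => X i + δ) (fun i => by rw [hX]; ring)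
  have e1 : yshift (-δ) J x = xshiftI δ J x := by
    ext i; simp only [yshift, xshiftI]; ring
  have e2 : xshift (-κ) ν y = yshiftMu κ ν y := by
    ext i; simp only [xshift, yshiftMu]; ring
  have e3 : -δ - -κ = κ - δ := by ring
  rw [e1, e2, e3, neg_neg, neg_neg] at key
  rw [key,
    hb.pairFactor_swap (t := κ - δ) (s := κ - δ) (X := X) (p := fun i => x i - κ) (y := y)
      (W := W) (fun i j => by ring) (fun i j => by ring)
      (fun i j => Or.inr ⟨by ring, by ring⟩), disjSum_compl_compl, hb.sourceTerm_compl,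
      ← sourceTerm_sum_swap,
    sourceTerm_congr br _ δ rfl (z' := Sum.elim W fun i => x i - κ)
      (w' := Sum.elim y X), add_comm J.card]
  · ring
  · rintro (i | i) <;> simp only [Sum.elim_inl, Sum.elim_inr] <;> ring
  · rintro (i | i) <;> simp
end IsBracket

/-- Increase by one the entries outside of `J`. -/
def raiseOff {m : ℕ} (J : Finset (Fin m)) (μ : Fin m → ℕ) : Fin m → ℕ :=
  fun i => if i ∈ J then μ i else μ i + 1

theorem sum_raiseOff {m : ℕ} (J : Finset (Fin m)) (μ : Fin m → ℕ) :
    ∑ i, raiseOff J μ i + J.card = ∑ i, μ i + m := by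
  have : ∀ i, raiseOff J μ i + (if i ∈ J then 1 else 0) = μ i + 1 := fun i => by
    unfold raiseOff; split_ifs <;> rfl
  have h := Finset.sum_congr rfl fun i (_ : i ∈ univ) => this i
  simpa [sum_add_distrib] using h

theorem mem_idxSet {m r k : ℕ} {p : (Fin m → ℕ) × Finset (Fin r)} :
    p ∈ idxSet m r k ↔ ∑ i, p.1 i + p.2.card = k := by
  simp only [idxSet, mem_filter, mem_product, Fintype.mem_piFinset, mem_range, mem_univ, and_true,
    and_iff_right_iff_imp]
  intro h i
  have := single_le_sum (f := p.1) (fun _ _ => Nat.zero_le _) (mem_univ i)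
  omega

theorem raiseOff_injective {m : ℕ} (J : Finset (Fin m)) : Function.Injective (raiseOff J) := by
  intro μ ν h
  ext i
  have := congrFun h i
  unfold raiseOff at this
  split_ifs at this <;> omega

theorem raiseOff_sub {m : ℕ} (J : Finset (Fin m)) (n : Fin m → ℕ) (h : ∀ i, i ∉ J → n i ≠ 0) :
    raiseOff J (fun i => if i ∈ J then n i else n i - 1) = n := by
  ext i
  have := h i
  by_cases hi : i ∈ J
  · simp [raiseOff, hi]
  · have := this hi
    simp only [raiseOff, hi, if_false]
    omega

/-- Regrouping of a sum over pairs of indices according to the total shift. -/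
theorem sum_idxSet_sum_idxSet {m r : ℕ} (A : Finset (Fin m) ≃ Finset (Fin m))
    (B : Finset (Fin r) ≃ Finset (Fin r))
    (G : (Fin m → ℕ) → (Fin r → ℕ) → Finset (Fin m ⊕ Fin r) → ℂ)
    (hA : ∀ n l K i, i ∉ K.toLeft → n i = 0 → G n l K = 0)
    (hB : ∀ n l K j, j ∉ B K.toRight → l j = 0 → G n l K = 0) (k k' N : ℕ)
    (hN : k + k' + 2 ≤ N) :
    ∑ p ∈ idxSet m r k, ∑ q ∈ idxSet r m k',
        G (raiseOff (A q.2) p.1) (raiseOff (B p.2) q.1) ((A q.2).disjSum p.2)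
      = ∑ n ∈ Fintype.piFinset fun _ : Fin m => range N,
          ∑ l ∈ Fintype.piFinset fun _ : Fin r => range N, ∑ K : Finset (Fin m ⊕ Fin r),
            if ∑ i, n i + K.card = k + m ∧
              ∑ j, l j + (B K.toRight).card + (A.symm K.toLeft).card = k' + r
            then G n l K else 0 := by
  have hle : ∀ {s k : ℕ} (J : Finset (Fin s)) (μ : Fin s → ℕ) (i : Fin s), ∑ i, μ i ≤ k →
      raiseOff J μ i ≤ k + 1 := fun J μ i h => by
    have := single_le_sum (f := μ) (fun _ _ => Nat.zero_le _) (mem_univ i)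
    unfold raiseOff
    split_ifs <;> omega
  simp only [← sum_product']
  rw [← sum_filter]
  refine sum_of_injOn (fun s => (raiseOff (A s.2.2) s.1.1, raiseOff (B s.1.2) s.2.1,
    (A s.2.2).disjSum s.1.2)) ?_ ?_ ?_ ?_
  · rintro ⟨⟨μ, I⟩, ν, J⟩ - ⟨⟨μ', I'⟩, ν', J'⟩ - h
    simp only [Prod.mk.injEq] at h
    obtain ⟨h1, h2, h3⟩ := h
    have hJ := congrArg toLeft h3
    have hI := congrArg toRight h3
    rw [toLeft_disjSum, toLeft_disjSum] at hJ
    rw [toRight_disjSum, toRight_disjSum] at hI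
    rw [hJ] at h1
    rw [hI] at h2
    rw [raiseOff_injective _ h1, raiseOff_injective _ h2, A.injective hJ, hI]
  · rintro ⟨⟨μ, I⟩, ν, J⟩ h
    simp only [coe_product, Set.mem_prod, mem_coe, mem_idxSet] at h
    obtain ⟨h1, h2⟩ := h
    simp only [coe_filter, Set.mem_ofPred_eq, mem_product, Fintype.mem_piFinset, mem_range,
      mem_univ, and_true, toLeft_disjSum, toRight_disjSum, card_disjSum, Equiv.symm_apply_apply]
    have e1 := sum_raiseOff (A J) μ
    have e2 := sum_raiseOff (B I) ν
    refine ⟨⟨fun i => ?_, fun j => ?_⟩, by omega, by omega⟩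
    · have := hle (k := k) (A J) μ i (by omega)
      omega
    · have := hle (k := k') (B I) ν j (by omega)
      omega
  · rintro ⟨n, l, K⟩ h hK
    simp only [mem_filter, mem_product, Fintype.mem_piFinset, mem_range, mem_univ, and_true] at h
    obtain ⟨-, h1, h2⟩ := h
    by_cases hn : ∀ i, i ∉ K.toLeft → n i ≠ 0
    · by_cases hl : ∀ j, j ∉ B K.toRight → l j ≠ 0
      · refine absurd ?_ hK
        have e1 := sum_raiseOff K.toLeft fun i => if i ∈ K.toLeft then n i else n i - 1
        have e2 := sum_raiseOff (B K.toRight) fun i => if i ∈ B K.toRight then l i else l i - 1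
        rw [raiseOff_sub _ _ hn] at e1
        rw [raiseOff_sub _ _ hl] at e2
        have := K.card_toLeft_add_card_toRight
        refine ⟨((fun i => if i ∈ K.toLeft then n i else n i - 1, K.toRight),
          (fun i => if i ∈ B K.toRight then l i else l i - 1, A.symm K.toLeft)), ?_, ?_⟩
        rotate_left
        · simp only [Equiv.apply_symm_apply, Prod.mk.injEq]
          exact ⟨raiseOff_sub _ _ hn, raiseOff_sub _ _ hl, K.toLeft_disjSum_toRight⟩
        · simp only [coe_product, Set.mem_prod, mem_coe, mem_idxSet]
          constructor <;> omega
      · push Not at hl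
        obtain ⟨j, hj, h0⟩ := hl
        exact hB _ _ _ j hj h0
    · push Not at hn
      obtain ⟨i, hi, h0⟩ := hn
      exact hA _ _ _ i hi h0
  · rintro ⟨⟨μ, I⟩, ν, J⟩ -
    rfl

theorem IsBracket.sourceTerm_eq_zero {br : ℂ → ℂ} (hb : IsBracket br) {ι : Type*} [Fintype ι]
    [DecidableEq ι] {t : ℂ} {z w : ι → ℂ} {K : Finset ι} (a : ι)
    (h : z a - w a = if a ∈ K then 0 else t) : sourceTerm br t z w K = 0 := by
  have h0 : br (z a - w a - if a ∈ K then 0 else t) = 0 := by rw [h, sub_self, hb.map_zero]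
  rw [sourceTerm, prod_eq_zero (mem_univ a) (prod_eq_zero (mem_univ a) h0), mul_zero]

theorem Generic.sum_elim_ne_zero {br : ℂ → ℂ} (hb : IsBracket br) {δ κ : ℂ} {m r : ℕ}
    {x : Fin m → ℂ} {y : Fin r → ℂ} (h : Generic br δ κ x y) (a b : Fin m ⊕ Fin r) (hab : a ≠ b) :
    br (Sum.elim x y a - Sum.elim x y b) ≠ 0 := by
  rcases a with a | a <;> rcases b with b | b
  · exact h.left.ne_zero a b 0 0 (fun e => absurd (congrArg Sum.inl e) hab) (by simp)
  · simpa using h.cross a b 0 0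
  · have := h.cross b a 0 0
    rw [Sum.elim_inl, Sum.elim_inr, hb.swap, neg_ne_zero]
    simpa using this
  · exact h.right.ne_zero a b 0 0 (fun e => absurd (congrArg Sum.inr e) hab) (by simp)

/-- The total shift of the `x` variables. -/
def totalShift (δ : ℂ) {m : ℕ} (n : Fin m → ℕ) (x : Fin m → ℂ) : Fin m → ℂ :=
  fun i => x i + δ * (n i - 1)

/-- The contribution of a total shift to the product of two operators shifting in opposite
directions. -/
noncomputable def oppositeTerm (br : ℂ → ℂ) (δ κ : ℂ) {m r : ℕ}
    (F : (Fin m → ℂ) → (Fin r → ℂ) → ℂ) (x : Fin m → ℂ) (y : Fin r → ℂ) (n : Fin m → ℕ)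
    (l : Fin r → ℕ) : ℂ :=
  shiftWeight br δ κ n x * shiftWeight br κ δ l y *
      pairFactor br (κ - δ) 0 (totalShift δ n x) (fun i => x i - κ) y
        (fun j => totalShift κ l y j + δ) * F (totalShift δ n x) (totalShift κ l y)

/-- The contribution of a total shift to the product of two operators shifting in the same
direction. -/
noncomputable def parallelTerm (br : ℂ → ℂ) (δ κ : ℂ) {m r : ℕ}
    (F : (Fin m → ℂ) → (Fin r → ℂ) → ℂ) (x : Fin m → ℂ) (y : Fin r → ℂ) (n : Fin m → ℕ)
    (l : Fin r → ℕ) : ℂ :=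
  shiftWeight br δ κ n x * shiftWeight br (-κ) (-δ) l y *
      pairFactor br (κ - δ) (κ - δ) (totalShift δ n x) (fun i => x i - κ) y (yshiftMu κ l y) *
    F (xshift δ n x) (yshiftMu κ l y)

theorem sum_add_card_compl_iff {m r : ℕ} (l : Fin r → ℕ) (K : Finset (Fin m ⊕ Fin r)) (k' : ℕ) :
    ∑ j, l j + #K.toRightᶜ + #K.toLeftᶜ = k' + r ↔ ∑ j, l j + m = k' + #K := by
  have h1 := card_add_card_compl K.toLeft
  have h2 := card_add_card_compl K.toRight
  have h3 := K.card_toLeft_add_card_toRight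
  rw [Fintype.card_fin] at h1 h2
  omega

theorem neg_one_pow_card_compl {m : ℕ} (J : Finset (Fin m)) :
    (-1 : ℂ) ^ #J = (-1) ^ (m + #Jᶜ) := by
  have h1 := card_add_card_compl J
  rw [Fintype.card_fin] at h1
  have h2 : m + #Jᶜ = #J + 2 * #Jᶜ := by omega
  rw [h2, pow_add, pow_mul]
  simp

namespace IsBracket
variable {br : ℂ → ℂ} {δ κ : ℂ} {m r : ℕ} {x : Fin m → ℂ} {y : Fin r → ℂ}

theorem hop_dhat (hb : IsBracket br) (h : Generic br δ κ x y) (k k' N : ℕ) (hN : k + k' + 2 ≤ N)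
    (F : (Fin m → ℂ) → (Fin r → ℂ) → ℂ) :
    Hop br δ κ m r k (Dhat br δ κ m r k' F) x y
      = ∑ n ∈ Fintype.piFinset fun _ : Fin m => range N,
          ∑ l ∈ Fintype.piFinset fun _ : Fin r => range N, oppositeTerm br δ κ F x y n l *
            ∑ K : Finset (Fin m ⊕ Fin r),
              (if ∑ i, n i + K.card = k + m ∧ ∑ j, l j + K.card = k' + r then (-1) ^ K.card
                else 0) *
              sourceTerm br (κ - δ) (Sum.elim (totalShift δ n x) y)
                (Sum.elim (fun i => x i - κ) (fun j => totalShift κ l y j + δ)) K := by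
  have key := sum_idxSet_sum_idxSet (Equiv.refl (Finset (Fin m))) (Equiv.refl (Finset (Fin r)))
    (fun n l K => oppositeTerm br δ κ F x y n l * ((-1) ^ K.card *
      sourceTerm br (κ - δ) (Sum.elim (totalShift δ n x) y)
        (Sum.elim (fun i => x i - κ) (fun j => totalShift κ l y j + δ)) K))
    (fun n l K i hi h0 => by
      rw [hb.sourceTerm_eq_zero (Sum.inl i), mul_zero, mul_zero]
      rw [mem_toLeft] at hi
      simp only [Sum.elim_inl, totalShift, h0, if_neg hi]
      push_cast; ring)
    (fun n l K j hj h0 => by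
      rw [hb.sourceTerm_eq_zero (Sum.inr j), mul_zero, mul_zero]
      rw [Equiv.refl_apply, mem_toRight] at hj
      simp only [Sum.elim_inr, totalShift, h0, if_neg hj]
      push_cast; ring) k k' N hN
  simp only [Hop, Dhat, mul_sum]
  refine Eq.trans (sum_congr rfl fun p hp => sum_congr rfl fun q hq => ?_) (key.trans ?_)
  · rw [← mul_assoc, hb.coef_mul_coef_opposite h p.1 (raiseOff q.2 p.1) q.1 (raiseOff p.2 q.1)
      p.2 q.2 (fun _ => rfl) (fun _ => rfl) (totalShift δ (raiseOff q.2 p.1) x) (fun _ => rfl)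
      (fun j => totalShift κ (raiseOff p.2 q.1) y j + δ) (fun _ => rfl)]
    have e1 : xshiftI (-δ) q.2 (xshift δ p.1 x) = totalShift δ (raiseOff q.2 p.1) x := by
      ext i
      by_cases hi : i ∈ q.2 <;> simp [xshiftI, xshift, totalShift, raiseOff, hi] <;> ring
    have e2 : yshiftMu (-κ) q.1 (yshift κ p.2 y) = totalShift κ (raiseOff p.2 q.1) y := by
      ext i
      by_cases hi : i ∈ p.2 <;> simp [yshiftMu, yshift, totalShift, raiseOff, hi] <;> ring
    rw [e1, e2, Equiv.refl_apply, Equiv.refl_apply, card_disjSum, oppositeTerm, add_comm #q.2]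
    ring
  · refine sum_congr rfl fun n _ => sum_congr rfl fun l _ => sum_congr rfl fun K _ => ?_
    rw [Equiv.refl_apply, Equiv.refl_symm, Equiv.refl_apply, add_assoc (∑ j, l j),
      add_comm #K.toRight, card_toLeft_add_card_toRight]
    split_ifs <;> simp

theorem dhat_hop (hb : IsBracket br) (h : Generic br δ κ x y) (k k' N : ℕ) (hN : k + k' + 2 ≤ N)
    (F : (Fin m → ℂ) → (Fin r → ℂ) → ℂ) :
    Dhat br δ κ m r k' (Hop br δ κ m r k F) x y
      = ∑ n ∈ Fintype.piFinset fun _ : Fin m => range N,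
          ∑ l ∈ Fintype.piFinset fun _ : Fin r => range N, oppositeTerm br δ κ F x y n l *
            ((-1) ^ (m + r) * ∑ K : Finset (Fin m ⊕ Fin r),
              (if ∑ i, n i + K.card = k + m ∧ ∑ j, l j + K.card = k' + r then (-1) ^ K.card
                else 0) *
              sourceTerm br (-(κ - δ))
                (Sum.elim (fun i => x i - κ) (fun j => totalShift κ l y j + δ))
                (Sum.elim (totalShift δ n x) y) K) := by
  have key := sum_idxSet_sum_idxSet (Equiv.refl (Finset (Fin m))) (Equiv.refl (Finset (Fin r)))
    (fun n l K => oppositeTerm br δ κ F x y n l * ((-1) ^ (m + r) * ((-1) ^ K.card *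
      sourceTerm br (-(κ - δ)) (Sum.elim (fun i => x i - κ) (fun j => totalShift κ l y j + δ))
                (Sum.elim (totalShift δ n x) y) K)))
    (fun n l K i hi h0 => by
      rw [hb.sourceTerm_eq_zero (Sum.inl i), mul_zero, mul_zero, mul_zero]
      rw [mem_toLeft] at hi
      simp only [Sum.elim_inl, totalShift, h0, if_neg hi]
      push_cast; ring)
    (fun n l K j hj h0 => by
      rw [hb.sourceTerm_eq_zero (Sum.inr j), mul_zero, mul_zero, mul_zero]
      rw [Equiv.refl_apply, mem_toRight] at hj
      simp only [Sum.elim_inr, totalShift, h0, if_neg hj]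
      push_cast; ring) k k' N hN
  simp only [Hop, Dhat, mul_sum]
  rw [sum_comm]
  refine Eq.trans (sum_congr rfl fun p hp => sum_congr rfl fun q hq => ?_) (key.trans ?_)
  · rw [← mul_assoc, hb.coef_mul_coef_opposite_rev h p.1 (raiseOff q.2 p.1) q.1 (raiseOff p.2 q.1)
      p.2 q.2 (fun _ => rfl) (fun _ => rfl) (totalShift δ (raiseOff q.2 p.1) x) (fun _ => rfl)
      (fun j => totalShift κ (raiseOff p.2 q.1) y j + δ) (fun _ => rfl)]
    have e1 : xshift δ p.1 (xshiftI (-δ) q.2 x) = totalShift δ (raiseOff q.2 p.1) x := by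
      ext i
      by_cases hi : i ∈ q.2 <;> simp [xshiftI, xshift, totalShift, raiseOff, hi] <;> ring
    have e2 : yshift κ p.2 (yshiftMu (-κ) q.1 y) = totalShift κ (raiseOff p.2 q.1) y := by
      ext i
      by_cases hi : i ∈ p.2 <;> simp [yshiftMu, yshift, totalShift, raiseOff, hi] <;> ring
    rw [e1, e2, Equiv.refl_apply, Equiv.refl_apply, card_disjSum, oppositeTerm, add_comm #q.2]
    ring
  · refine sum_congr rfl fun n _ => sum_congr rfl fun l _ => sum_congr rfl fun K _ => ?_
    rw [Equiv.refl_apply, Equiv.refl_symm, Equiv.refl_apply, add_assoc (∑ j, l j),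
      add_comm #K.toRight, card_toLeft_add_card_toRight]
    split_ifs <;> simp

theorem hop_dhat_comm (hb : IsBracket br) (h : Generic br δ κ x y) (k k' : ℕ)
    (F : (Fin m → ℂ) → (Fin r → ℂ) → ℂ) :
    Hop br δ κ m r k (Dhat br δ κ m r k' F) x y = Dhat br δ κ m r k' (Hop br δ κ m r k F) x y := by
  rw [hb.hop_dhat h k k' _ le_rfl, hb.dhat_hop h k k' _ le_rfl]
  refine sum_congr rfl fun n _ => sum_congr rfl fun l _ => congrArg _ ?_
  have hz : Generic br δ κ (totalShift δ n x) y := h.shift (fun i => n i - 1) 0 0 0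
    (fun i => by simp only [totalShift]; push_cast; simp; ring) (fun j => by simp)
  have hw : Generic br δ κ (fun i => x i - κ) (fun j => totalShift κ l y j + δ) :=
    h.shift 0 (fun _ => -1) (fun _ => 1) (fun j => l j - 1)
    (fun i => by push_cast; simp; ring)
    (fun j => by simp only [totalShift]; push_cast; ring)
  rw [hb.sum_sourceTerm _ _ _
    (fun c => if ∑ i, n i + c = k + m ∧ ∑ j, l j + c = k' + r then (-1) ^ c else 0)
    (hz.sum_elim_ne_zero hb) (hw.sum_elim_ne_zero hb)]
  simp

theorem hop_dop (hb : IsBracket br) (h : Generic br δ κ x y) (k k' N : ℕ) (hN : k + k' + 2 ≤ N)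
    (F : (Fin m → ℂ) → (Fin r → ℂ) → ℂ) :
    Hop br δ κ m r k (Dop br δ κ m r k' F) x y
      = ∑ n ∈ Fintype.piFinset fun _ : Fin m => range N,
          ∑ l ∈ Fintype.piFinset fun _ : Fin r => range N, parallelTerm br δ κ F x y n l *
            ∑ K : Finset (Fin m ⊕ Fin r),
              (if ∑ i, n i + K.card = k + m ∧ ∑ j, l j + m = k' + K.card then (-1) ^ (m + K.card)
                else 0) *
              sourceTerm br (κ - δ) (Sum.elim (totalShift δ n x) y)
                (Sum.elim (fun i => x i - κ) (yshiftMu κ l y)) K := by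
  have key := sum_idxSet_sum_idxSet ((compl_involutive (α := Finset (Fin m))).toPerm)
    ((compl_involutive (α := Finset (Fin r))).toPerm)
    (fun n l K => parallelTerm br δ κ F x y n l * ((-1) ^ (m + K.card) *
      sourceTerm br (κ - δ) (Sum.elim (totalShift δ n x) y)
        (Sum.elim (fun i => x i - κ) (yshiftMu κ l y)) K))
    (fun n l K i hi h0 => by
      rw [hb.sourceTerm_eq_zero (Sum.inl i), mul_zero, mul_zero]
      rw [mem_toLeft] at hi
      simp only [Sum.elim_inl, totalShift, h0, if_neg hi]
      push_cast; ring)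
    (fun n l K j hj h0 => by
      rw [hb.sourceTerm_eq_zero (Sum.inr j), mul_zero, mul_zero]
      rw [Function.Involutive.coe_toPerm, mem_compl, not_not, mem_toRight] at hj
      simp [yshiftMu, h0, hj]) k k' N hN
  simp only [Hop, Dop, mul_sum]
  refine Eq.trans (sum_congr rfl fun p hp => sum_congr rfl fun q hq => ?_) (key.trans ?_)
  · rw [← mul_assoc, hb.coef_mul_coef_parallel h p.1 (raiseOff q.2ᶜ p.1) q.1 (raiseOff p.2ᶜ q.1)
      p.2 q.2 (fun i => by simp only [raiseOff, mem_compl, ite_not])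
      (fun j => by simp only [raiseOff, mem_compl, ite_not]) (totalShift δ (raiseOff q.2ᶜ p.1) x) (fun _ => rfl)
      (yshiftMu κ (raiseOff p.2ᶜ q.1) y) (fun _ => rfl)]
    have e1 : xshiftI δ q.2 (xshift δ p.1 x) = xshift δ (raiseOff q.2ᶜ p.1) x := by
      ext i
      by_cases hi : i ∈ q.2 <;> simp [xshiftI, xshift, raiseOff, hi] <;> ring
    have e2 : yshiftMu κ q.1 (yshift κ p.2 y) = yshiftMu κ (raiseOff p.2ᶜ q.1) y := by
      ext i
      by_cases hi : i ∈ p.2 <;> simp [yshiftMu, yshift, raiseOff, hi] <;> ring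
    rw [e1, e2, Function.Involutive.coe_toPerm, Function.Involutive.coe_toPerm, card_disjSum,
      parallelTerm, ← add_assoc, pow_add _ (m + _), ← neg_one_pow_card_compl]
    ring
  · refine sum_congr rfl fun n _ => sum_congr rfl fun l _ => sum_congr rfl fun K _ => ?_
    rw [Function.Involutive.toPerm_symm, Function.Involutive.coe_toPerm,
      Function.Involutive.coe_toPerm, if_congr (and_congr_right' (sum_add_card_compl_iff l K k'))
      rfl rfl]
    split_ifs <;> simp

theorem dop_hop (hb : IsBracket br) (h : Generic br δ κ x y) (k k' N : ℕ) (hN : k + k' + 2 ≤ N)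
    (F : (Fin m → ℂ) → (Fin r → ℂ) → ℂ) :
    Dop br δ κ m r k' (Hop br δ κ m r k F) x y
      = ∑ n ∈ Fintype.piFinset fun _ : Fin m => range N,
          ∑ l ∈ Fintype.piFinset fun _ : Fin r => range N, parallelTerm br δ κ F x y n l *
            ((-1) ^ (m + r) * ∑ K : Finset (Fin m ⊕ Fin r),
              (if ∑ i, n i + K.card = k + m ∧ ∑ j, l j + m = k' + K.card then (-1) ^ (m + K.card)
                else 0) *
              sourceTerm br (-(κ - δ))
                (Sum.elim (fun i => x i - κ) (yshiftMu κ l y))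
                (Sum.elim (totalShift δ n x) y) K) := by
  have key := sum_idxSet_sum_idxSet ((compl_involutive (α := Finset (Fin m))).toPerm)
    ((compl_involutive (α := Finset (Fin r))).toPerm)
    (fun n l K => parallelTerm br δ κ F x y n l * ((-1) ^ (m + r) * ((-1) ^ (m + K.card) *
      sourceTerm br (-(κ - δ)) (Sum.elim (fun i => x i - κ) (yshiftMu κ l y))
                (Sum.elim (totalShift δ n x) y) K)))
    (fun n l K i hi h0 => by
      rw [hb.sourceTerm_eq_zero (Sum.inl i), mul_zero, mul_zero, mul_zero]
      rw [mem_toLeft] at hi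
      simp only [Sum.elim_inl, totalShift, h0, if_neg hi]
      push_cast; ring)
    (fun n l K j hj h0 => by
      rw [hb.sourceTerm_eq_zero (Sum.inr j), mul_zero, mul_zero, mul_zero]
      rw [Function.Involutive.coe_toPerm, mem_compl, not_not, mem_toRight] at hj
      simp [yshiftMu, h0, hj]) k k' N hN
  simp only [Hop, Dop, mul_sum]
  rw [sum_comm]
  refine Eq.trans (sum_congr rfl fun p hp => sum_congr rfl fun q hq => ?_) (key.trans ?_)
  · rw [← mul_assoc, hb.coef_mul_coef_parallel_rev h p.1 (raiseOff q.2ᶜ p.1) q.1 (raiseOff p.2ᶜ q.1)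
      p.2 q.2 (fun i => by simp only [raiseOff, mem_compl, ite_not])
      (fun j => by simp only [raiseOff, mem_compl, ite_not]) (totalShift δ (raiseOff q.2ᶜ p.1) x) (fun _ => rfl)
      (yshiftMu κ (raiseOff p.2ᶜ q.1) y) (fun _ => rfl)]
    have e1 : xshift δ p.1 (xshiftI δ q.2 x) = xshift δ (raiseOff q.2ᶜ p.1) x := by
      ext i
      by_cases hi : i ∈ q.2 <;> simp [xshiftI, xshift, raiseOff, hi] <;> ring
    have e2 : yshift κ p.2 (yshiftMu κ q.1 y) = yshiftMu κ (raiseOff p.2ᶜ q.1) y := by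
      ext i
      by_cases hi : i ∈ p.2 <;> simp [yshiftMu, yshift, raiseOff, hi] <;> ring
    rw [e1, e2, Function.Involutive.coe_toPerm, Function.Involutive.coe_toPerm, card_disjSum,
      parallelTerm, ← add_assoc, pow_add _ (m + _), ← neg_one_pow_card_compl]
    ring
  · refine sum_congr rfl fun n _ => sum_congr rfl fun l _ => sum_congr rfl fun K _ => ?_
    rw [Function.Involutive.toPerm_symm, Function.Involutive.coe_toPerm,
      Function.Involutive.coe_toPerm, if_congr (and_congr_right' (sum_add_card_compl_iff l K k'))
      rfl rfl]
    split_ifs <;> simp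

theorem hop_dop_comm (hb : IsBracket br) (h : Generic br δ κ x y) (k k' : ℕ)
    (F : (Fin m → ℂ) → (Fin r → ℂ) → ℂ) :
    Hop br δ κ m r k (Dop br δ κ m r k' F) x y = Dop br δ κ m r k' (Hop br δ κ m r k F) x y := by
  rw [hb.hop_dop h k k' _ le_rfl, hb.dop_hop h k k' _ le_rfl]
  refine sum_congr rfl fun n _ => sum_congr rfl fun l _ => congrArg _ ?_
  have hz : Generic br δ κ (totalShift δ n x) y := h.shift (fun i => n i - 1) 0 0 0
    (fun i => by simp only [totalShift]; push_cast; simp; ring) (fun j => by simp)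
  have hw : Generic br δ κ (fun i => x i - κ) (yshiftMu κ l y) :=
    h.shift 0 (fun _ => -1) 0 (fun j => - l j)
    (fun i => by push_cast; simp; ring)
    (fun j => by simp only [yshiftMu]; push_cast; simp; ring)
  rw [hb.sum_sourceTerm _ _ _
    (fun c => if ∑ i, n i + c = k + m ∧ ∑ j, l j + m = k' + c then (-1) ^ (m + c) else 0)
    (hz.sum_elim_ne_zero hb) (hw.sum_elim_ne_zero hb)]
  simp

end IsBracket

namespace IsBracket
variable {br : ℂ → ℂ} {δ κ : ℂ} {m r : ℕ} {x : Fin m → ℂ} {y : Fin r → ℂ}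

theorem parallel_sourceTerm_eq_zero (hb : IsBracket br) (n : Fin m → ℕ) (l : Fin r → ℕ)
    (K : Finset (Fin m ⊕ Fin r)) (h : ∑ i, n i + #K < m ∨ ∑ j, l j + m < #K) :
    sourceTerm br (κ - δ) (Sum.elim (totalShift δ n x) y)
      (Sum.elim (fun i => x i - κ) (yshiftMu κ l y)) K = 0 := by
  have hK := K.card_toLeft_add_card_toRight
  have hc := card_add_card_compl K.toLeft
  rw [Fintype.card_fin] at hc
  rcases h with h | h
  · obtain ⟨i, hi, h0⟩ : ∃ i ∈ K.toLeftᶜ, n i = 0 := by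
      by_contra! hne
      have h1 : #K.toLeftᶜ • 1 ≤ ∑ i ∈ K.toLeftᶜ, n i :=
        card_nsmul_le_sum _ _ _ fun i hi => Nat.one_le_iff_ne_zero.2 (hne i hi)
      have h2 := sum_le_univ_sum_of_nonneg (s := K.toLeftᶜ) (f := n) fun _ => Nat.zero_le _
      rw [smul_eq_mul] at h1
      omega
    refine hb.sourceTerm_eq_zero (Sum.inl i) ?_
    rw [mem_compl, mem_toLeft] at hi
    simp only [Sum.elim_inl, totalShift, h0, if_neg hi]
    push_cast; ring
  · obtain ⟨j, hj, h0⟩ : ∃ j ∈ K.toRight, l j = 0 := by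
      by_contra! hne
      have h1 : #K.toRight • 1 ≤ ∑ i ∈ K.toRight, l i :=
        card_nsmul_le_sum _ _ _ fun i hi => Nat.one_le_iff_ne_zero.2 (hne i hi)
      have h2 := sum_le_univ_sum_of_nonneg (s := K.toRight) (f := l) fun _ => Nat.zero_le _
      rw [smul_eq_mul] at h1
      omega
    refine hb.sourceTerm_eq_zero (Sum.inr j) ?_
    rw [mem_toRight] at hj
    simp [yshiftMu, h0, hj]

/-- A Wronski type relation between the two families of operators. -/
theorem sum_antidiagonal_hop_dop (hb : IsBracket br) (h : Generic br δ κ x y) (k : ℕ)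
    (F : (Fin m → ℂ) → (Fin r → ℂ) → ℂ) :
    ∑ c ∈ HasAntidiagonal.antidiagonal k,
      br (c.1 * δ + c.2 * κ) * Hop br δ κ m r c.1 (Dop br δ κ m r c.2 F) x y = 0 := by
  have hc : ∀ c ∈ HasAntidiagonal.antidiagonal k, c.1 + c.2 + 2 ≤ k + 2 := fun c hc => by
    rw [HasAntidiagonal.mem_antidiagonal] at hc; omega
  rw [sum_congr rfl fun c hk => by rw [hb.hop_dop h c.1 c.2 (k + 2) (hc c hk)]]
  simp only [mul_sum]
  rw [sum_comm]
  refine sum_eq_zero fun n _ => ?_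
  rw [sum_comm]
  refine sum_eq_zero fun l _ => ?_
  rw [sum_comm]
  by_cases hk : ∑ i, n i + ∑ j, l j = k
  · have hz : Generic br δ κ (totalShift δ n x) y := h.shift (fun i => n i - 1) 0 0 0
      (fun i => by simp only [totalShift]; push_cast; simp; ring) (fun j => by simp)
    have hw : Generic br δ κ (fun i => x i - κ) (yshiftMu κ l y) :=
      h.shift 0 (fun _ => -1) 0 (fun j => - l j) (fun i => by push_cast; simp; ring)
      (fun j => by simp only [yshiftMu]; push_cast; simp; ring)
    have key := congrArg (fun u => parallelTerm br δ κ F x y n l * (-1) ^ m * u)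
      (hb.sum_neg_one_pow_sourceTerm (κ - δ) _ _ (hz.sum_elim_ne_zero hb) (hw.sum_elim_ne_zero hb))
    simp only [mul_zero, mul_sum] at key
    refine Eq.trans (sum_congr rfl fun K _ => ?_) key
    by_cases hK : m ≤ ∑ i, n i + #K ∧ #K ≤ ∑ j, l j + m
    · rw [sum_eq_single (∑ i, n i + #K - m, ∑ j, l j + m - #K)]
      · rw [if_pos ⟨by simp only; omega, by simp only; omega⟩]
        have e : ∑ i, (Sum.elim (totalShift δ n x) y i -
            Sum.elim (fun i => x i - κ) (yshiftMu κ l y) i) - #K * (κ - δ)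
            = ((∑ i, n i + #K - m : ℕ) : ℂ) * δ + ((∑ j, l j + m - #K : ℕ) : ℂ) * κ := by
          rw [Nat.cast_sub hK.1, Nat.cast_sub hK.2]
          have e1 : ∀ i, totalShift δ n x i - (x i - κ) = δ * n i + (κ - δ) := fun i => by
            simp only [totalShift]; ring
          have e2 : ∀ j, y j - yshiftMu κ l y j = κ * l j := fun j => by
            simp only [yshiftMu]; ring
          simp only [Fintype.sum_sum_type, Sum.elim_inl, Sum.elim_inr, e1, e2, sum_add_distrib,
            ← mul_sum, sum_const, card_univ, Fintype.card_fin, nsmul_eq_mul]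
          push_cast; ring
        rw [e, pow_add]; ring
      · rintro ⟨a, b⟩ - hne
        rw [if_neg]
        · simp
        · rintro ⟨h1, h2⟩
          refine hne (Prod.ext ?_ ?_) <;> simp only at h1 h2 ⊢ <;> omega
      · intro hn
        refine absurd (HasAntidiagonal.mem_antidiagonal.2 ?_) hn
        simp only
        omega
    · rw [hb.parallel_sourceTerm_eq_zero n l K (by omega)]
      simp
  · refine sum_eq_zero fun K _ => sum_eq_zero fun c hc => ?_
    rw [HasAntidiagonal.mem_antidiagonal] at hc
    rw [if_neg (by omega)]
    simp

end IsBracket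

theorem IsBracket.continuousAt_coef {br : ℂ → ℂ} (hb : IsBracket br) {Q : Type*}
    [TopologicalSpace Q] {m r : ℕ} (μ : Fin m → ℕ) (I : Finset (Fin r)) {a b : Q → ℂ}
    {x : Q → Fin m → ℂ} {y : Q → Fin r → ℂ} {P : Q} (ha : ContinuousAt a P) (hbc : ContinuousAt b P)
    (hx : ContinuousAt x P) (hy : ContinuousAt y P)
    (h : CDenomNZ br (a P) μ I (x P) (y P)) :
    ContinuousAt (fun P => Coef br (a P) (b P) μ I (x P) (y P)) P := by
  obtain ⟨h1, h2, h3, h4, h5⟩ := h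
  have hc : ∀ {u : Q → ℂ}, ContinuousAt u P → ContinuousAt (fun P => br (u P)) P :=
    fun hu => (hb.continuous.continuousAt).comp hu
  have hx' := fun i => (continuous_apply i).continuousAt.comp hx
  have hy' := fun i => (continuous_apply i).continuousAt.comp hy
  simp only [Function.comp_def] at hx' hy'
  have hs : ∀ {u : Q → ℂ} (n : ℕ), ContinuousAt u P →
      ContinuousAt (fun P => sfac br (a P) (u P) (n : ℤ)) P := fun n hu => by
    simp only [sfac_natCast]
    exact tendsto_finsetProd _ fun i _ => hc (hu.add (continuousAt_const.mul ha))
  unfold Coef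
  refine (((continuousAt_const.mul ?_).mul ?_).mul ?_).mul ?_
  · refine tendsto_finsetProd _ fun i _ => tendsto_finsetProd _ fun j _ => ?_
    by_cases hij : i < j
    · simp only [hij, if_true]
      exact (hc (((hx' i).sub (hx' j)).add (continuousAt_const.mul ha))).div
        (hc ((hx' i).sub (hx' j))) (h1 i j hij)
    · simp only [hij, if_false]
      exact tendsto_const_nhds
  · exact tendsto_finsetProd _ fun i hi => tendsto_finsetProd _ fun j hj =>
      (hc (((hy' i).sub (hy' j)).sub ha)).div (hc ((hy' i).sub (hy' j))) (h2 i hi j hj)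
  · exact tendsto_finsetProd _ fun i _ => tendsto_finsetProd _ fun j _ =>
      (hs _ (((hx' i).sub (hx' j)).add hbc)).div (hs _ (((hx' i).sub (hx' j)).add ha)) (h3 i j)
  · refine tendsto_finsetProd _ fun i _ => Tendsto.mul ?_ ?_
    · exact tendsto_finsetProd _ fun j hj => (hc (((hx' i).sub (hy' j)).sub hbc)).div
        (hc (((hx' i).sub (hy' j)).add (continuousAt_const.mul ha))) (h4 i j hj)
    · exact tendsto_finsetProd _ fun j hj => (hc (((hx' i).sub (hy' j)).sub ha)).div
        (hc (((hx' i).sub (hy' j)).add (continuousAt_const.mul ha))) (h5 i j hj)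

/-- The translate of `x` by an integer multiple of `c` in each coordinate. -/
def latticeShift (c : ℂ) {m : ℕ} (a : Fin m → ℤ) (x : Fin m → ℂ) : Fin m → ℂ :=
  fun i => x i + c * a i

/-- Each operator is a linear combination of shifts, whose coefficients are continuous at
admissible points. -/
theorem IsBracket.opFam_eq_sum {br : ℂ → ℂ} (hb : IsBracket br) (m r : ℕ) (f : Fin 4) (k : ℕ) :
    ∃ (ι : Type) (S : Finset ι) (c : ι → ℂ → ℂ → (Fin m → ℂ) → (Fin r → ℂ) → ℂ)
      (a : ι → Fin m → ℤ) (b : ι → Fin r → ℤ), ∀ δ κ x y,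
      (∀ F, OpFam br δ κ m r f k F x y
        = ∑ s ∈ S, c s δ κ x y * F (latticeShift δ (a s) x) (latticeShift κ (b s) y)) ∧
      (∀ s ∈ S, (latticeShift δ (a s) x, latticeShift κ (b s) y) ∈ FamShifts δ κ m r f k x y) ∧
      (FamAdm br δ κ m r f k x y → ∀ s ∈ S, ContinuousAt
        (fun P : (ℂ × ℂ) × (Fin m → ℂ) × (Fin r → ℂ) => c s P.1.1 P.1.2 P.2.1 P.2.2)
        ((δ, κ), (x, y))) := by
  have c1 : Continuous fun P : (ℂ × ℂ) × (Fin m → ℂ) × (Fin r → ℂ) => P.1.1 := by fun_prop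
  have c2 : Continuous fun P : (ℂ × ℂ) × (Fin m → ℂ) × (Fin r → ℂ) => P.1.2 := by fun_prop
  have c3 : Continuous fun P : (ℂ × ℂ) × (Fin m → ℂ) × (Fin r → ℂ) => P.2.1 := by fun_prop
  have c4 : Continuous fun P : (ℂ × ℂ) × (Fin m → ℂ) × (Fin r → ℂ) => P.2.2 := by fun_prop
  have c5 : Continuous fun P : (ℂ × ℂ) × (Fin m → ℂ) × (Fin r → ℂ) => fun i => P.2.1 i - P.1.1 := by
    fun_prop
  have c6 : Continuous fun P : (ℂ × ℂ) × (Fin m → ℂ) × (Fin r → ℂ) => fun i => P.2.2 i + P.1.2 := by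
    fun_prop
  fin_cases f
  · refine ⟨_, idxSet m r k, fun p δ κ x y => Coef br δ κ p.1 p.2 x y, fun p i => p.1 i,
      fun p j => -(if j ∈ p.2 then 1 else 0), fun δ κ x y => ?_⟩
    have e1 : ∀ (μ : Fin m → ℕ), latticeShift δ (fun i => μ i) x = xshift δ μ x := fun μ => by
      ext i; simp [latticeShift, xshift]
    have e2 : ∀ (I : Finset (Fin r)), latticeShift κ (fun j => -(if j ∈ I then 1 else 0)) y
      = yshift κ I y := fun I => by
      ext j; by_cases hj : j ∈ I <;> simp [latticeShift, yshift, hj, sub_eq_add_neg]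
    simp only [e1, e2]
    refine ⟨fun F => by simp [OpFam, Hop], fun p hp => ⟨p, hp, rfl⟩, fun h p hp => ?_⟩
    exact hb.continuousAt_coef p.1 p.2 c1.continuousAt c2.continuousAt c3.continuousAt
      c4.continuousAt (h p hp)
  · refine ⟨_, idxSet m r k, fun p δ κ x y =>
      Coef br (-δ) (-κ) p.1 p.2 (fun i => x i - δ) (fun j => y j + κ), fun p i => -p.1 i,
      fun p j => if j ∈ p.2 then 1 else 0, fun δ κ x y => ?_⟩
    have e1 : ∀ (μ : Fin m → ℕ), latticeShift δ (fun i => -μ i) x = xshift (-δ) μ x := fun μ => by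
      ext i; simp [latticeShift, xshift]
    have e2 : ∀ (I : Finset (Fin r)), latticeShift κ (fun j => if j ∈ I then 1 else 0) y
      = yshift (-κ) I y := fun I => by
      ext j; by_cases hj : j ∈ I <;> simp [latticeShift, yshift, hj]
    simp only [e1, e2]
    refine ⟨fun F => by simp [OpFam, Hhat], fun p hp => ⟨p, hp, rfl⟩, fun h p hp => ?_⟩
    exact hb.continuousAt_coef p.1 p.2 c1.neg.continuousAt c2.neg.continuousAt c5.continuousAt
      c6.continuousAt (h p hp)
  · refine ⟨_, idxSet r m k, fun p δ κ x y => Coef br (-κ) (-δ) p.1 p.2 y x,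
      fun p j => if j ∈ p.2 then 1 else 0, fun p i => -p.1 i, fun δ κ x y => ?_⟩
    have e1 : ∀ (μ : Fin r → ℕ), latticeShift κ (fun i => -μ i) y = yshiftMu κ μ y := fun μ => by
      ext i; simp [latticeShift, yshiftMu, sub_eq_add_neg]
    have e2 : ∀ (I : Finset (Fin m)), latticeShift δ (fun j => if j ∈ I then 1 else 0) x
      = xshiftI δ I x := fun I => by
      ext j; by_cases hj : j ∈ I <;> simp [latticeShift, xshiftI, hj]
    simp only [e1, e2]
    refine ⟨fun F => by simp [OpFam, Dop], fun p hp => ⟨p, hp, rfl⟩, fun h p hp => ?_⟩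
    exact hb.continuousAt_coef p.1 p.2 c2.neg.continuousAt c1.neg.continuousAt c4.continuousAt
      c3.continuousAt (h p hp)
  · refine ⟨_, idxSet r m k, fun p δ κ x y =>
      Coef br κ δ p.1 p.2 (fun j => y j + κ) (fun i => x i - δ),
      fun p j => -(if j ∈ p.2 then 1 else 0), fun p i => p.1 i, fun δ κ x y => ?_⟩
    have e1 : ∀ (μ : Fin r → ℕ), latticeShift κ (fun i => μ i) y = yshiftMu (-κ) μ y := fun μ => by
      ext i; simp [latticeShift, yshiftMu]
    have e2 : ∀ (I : Finset (Fin m)), latticeShift δ (fun j => -(if j ∈ I then 1 else 0)) x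
      = xshiftI (-δ) I x := fun I => by
      ext j; by_cases hj : j ∈ I <;> simp [latticeShift, xshiftI, hj]
    simp only [e1, e2]
    refine ⟨fun F => by simp [OpFam, Dhat], fun p hp => ⟨p, hp, rfl⟩, fun h p hp => ?_⟩
    exact hb.continuousAt_coef p.1 p.2 c2.continuousAt c1.continuousAt c6.continuousAt
      c5.continuousAt (h p hp)

section
variable (br : ℂ → ℂ) (δ κ : ℂ) (m r k : ℕ) (F : (Fin m → ℂ) → (Fin r → ℂ) → ℂ)

theorem dop_eq_hop : Dop br δ κ m r k F
    = fun x y => Hop br (-κ) (-δ) r m k (fun y x => F x y) y x := by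
  funext x y
  simp only [Dop, Hop]
  refine sum_congr rfl fun p _ => ?_
  congr 2 <;> ext i <;> simp only [xshiftI, yshift, xshift, yshiftMu] <;> ring

theorem dhat_eq_hhat : Dhat br δ κ m r k F
    = fun x y => Hhat br (-κ) (-δ) r m k (fun y x => F x y) y x := by
  funext x y
  simp only [Dhat, Hhat, neg_neg, sub_neg_eq_add, ← sub_eq_add_neg]
  refine sum_congr rfl fun p _ => ?_
  congr 2 <;> ext i <;> simp only [xshiftI, yshift, xshift, yshiftMu] <;> ring

theorem hhat_eq_hop : Hhat br δ κ m r k F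
    = fun x y => Hop br (-δ) (-κ) m r k (fun x y => F (fun i => x i + δ) (fun j => y j - κ))
      (fun i => x i - δ) (fun j => y j + κ) := by
  funext x y
  simp only [Hop, Hhat]
  refine sum_congr rfl fun p _ => ?_
  congr 2 <;> ext i <;> simp only [yshift, xshift] <;> ring

theorem dhat_eq_dop : Dhat br δ κ m r k F
    = fun x y => Dop br (-δ) (-κ) m r k (fun x y => F (fun i => x i + δ) (fun j => y j - κ))
      (fun i => x i - δ) (fun j => y j + κ) := by
  funext x y
  simp only [Dop, Dhat, neg_neg]
  refine sum_congr rfl fun p _ => ?_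
  congr 2 <;> ext i <;> simp only [xshiftI, yshiftMu] <;> ring

end

section
variable {br : ℂ → ℂ} {δ κ : ℂ} {m r : ℕ} {x : Fin m → ℂ} {y : Fin r → ℂ}

theorem Generic.latticeShift (h : Generic br δ κ x y) (a : Fin m → ℤ) (b : Fin r → ℤ) :
    Generic br δ κ (latticeShift δ a x) (latticeShift κ b y) :=
  h.shift a 0 0 b (fun i => by simp [_root_.latticeShift, mul_comm])
    (fun j => by simp [_root_.latticeShift, mul_comm])

theorem Generic.sub_add (h : Generic br δ κ x y) :
    Generic br (-δ) (-κ) (fun i => x i - δ) (fun j => y j + κ) :=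
  (h.shift (fun _ => -1) 0 0 (fun _ => 1) (fun i => by simp [sub_eq_add_neg])
    (fun j => by simp)).neg

namespace IsBracket

theorem opFam_congr (hb : IsBracket br) (f : Fin 4) (k : ℕ)
    {F F' : (Fin m → ℂ) → (Fin r → ℂ) → ℂ} (hF : ∀ x y, Generic br δ κ x y → F x y = F' x y)
    (h : Generic br δ κ x y) : OpFam br δ κ m r f k F x y = OpFam br δ κ m r f k F' x y := by
  obtain ⟨ι, S, c, a, b, hS⟩ := hb.opFam_eq_sum m r f k
  rw [(hS δ κ x y).1, (hS δ κ x y).1]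
  exact sum_congr rfl fun s _ => by rw [hF _ _ (h.latticeShift _ _)]

theorem hop_zero (h : Generic br δ κ x y) (F : (Fin m → ℂ) → (Fin r → ℂ) → ℂ) :
    Hop br δ κ m r 0 F x y = F x y := by
  have hs : idxSet m r 0 = {(0, ∅)} := by
    ext ⟨μ, I⟩
    simp [mem_idxSet, funext_iff]
  have h1 : ∀ i j : Fin m, (if i < j then br (x i - x j) / br (x i - x j) else 1) = 1 := by
    intro i j
    split_ifs with hij
    · exact div_self (h.left.ne_zero i j 0 0 (fun e => absurd e hij.ne) (by simp))
    · rfl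
  have h2 : ∀ i j, br (x i - y j + -δ) ≠ 0 := fun i j => by simpa using h.cross i j (-1) 0
  have e1 : xshift δ 0 x = x := by ext; simp [xshift]
  have e2 : yshift κ ∅ y = y := by ext; simp [yshift]
  rw [Hop, hs, sum_singleton, e1, e2]
  simp [Coef, h1, sfac, sub_eq_add_neg _ δ, div_self (h2 _ _)]

theorem dop_zero (hb : IsBracket br) (h : Generic br δ κ x y)
    (F : (Fin m → ℂ) → (Fin r → ℂ) → ℂ) : Dop br δ κ m r 0 F x y = F x y := by
  rw [dop_eq_hop]
  exact hop_zero (h.swap hb).neg _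

theorem hop_recursion (hb : IsBracket br) (k : ℕ) (F : (Fin m → ℂ) → (Fin r → ℂ) → ℂ)
    (h : Generic br δ κ x y) :
    br (k * δ) * Hop br δ κ m r k F x y = -∑ c ∈ (HasAntidiagonal.antidiagonal k).erase (k, 0),
      br (c.1 * δ + c.2 * κ) * Hop br δ κ m r c.1 (Dop br δ κ m r c.2 F) x y := by
  have hD : Hop br δ κ m r k (Dop br δ κ m r 0 F) x y = Hop br δ κ m r k F x y :=
    hb.opFam_congr 0 k (fun x y h => hb.dop_zero h F) h
  rw [← hD, eq_neg_iff_add_eq_zero, ← hb.sum_antidiagonal_hop_dop h k F,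
    ← add_sum_erase _ _ (HasAntidiagonal.mem_antidiagonal (a := (k, 0)).2 (add_zero k))]
  simp

/-- An operator commuting with the second family commutes with the first family. -/
theorem hop_comm_of_dop_comm (hb : IsBracket br) (f : Fin 4) (l : ℕ)
    (hT : ∀ i F x y, Generic br δ κ x y → OpFam br δ κ m r f l (Dop br δ κ m r i F) x y
      = Dop br δ κ m r i (OpFam br δ κ m r f l F) x y) (k : ℕ)
    (F : (Fin m → ℂ) → (Fin r → ℂ) → ℂ) (h : Generic br δ κ x y) :
    OpFam br δ κ m r f l (Hop br δ κ m r k F) x y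
      = Hop br δ κ m r k (OpFam br δ κ m r f l F) x y := by
  induction k using Nat.strong_induction_on generalizing F x y with
  | _ k ih =>
  obtain ⟨ι, S, c, a, b, hS⟩ := hb.opFam_eq_sum m r f l
  rcases k.eq_zero_or_pos with rfl | hk
  · rw [hop_zero h]
    exact hb.opFam_congr f l (fun x y h => hop_zero h F) h
  have h0 : br (k * δ) ≠ 0 := by simpa using h.lattice k 0 (Or.inl (by omega))
  refine mul_left_cancel₀ h0 ?_
  rw [hb.hop_recursion k _ h, (hS δ κ x y).1, mul_sum]
  have e : ∀ s ∈ S, br (k * δ) * (c s δ κ x y * Hop br δ κ m r k F (latticeShift δ (a s) x)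
      (latticeShift κ (b s) y)) = -∑ d ∈ (HasAntidiagonal.antidiagonal k).erase (k, 0),
        br (d.1 * δ + d.2 * κ) * (c s δ κ x y * Hop br δ κ m r d.1 (Dop br δ κ m r d.2 F)
          (latticeShift δ (a s) x) (latticeShift κ (b s) y)) := fun s _ => by
    rw [mul_left_comm, hb.hop_recursion k F (h.latticeShift _ _), mul_neg, mul_sum]
    simp only [mul_left_comm]
  rw [sum_congr rfl e, sum_neg_distrib, sum_comm]
  refine congrArg Neg.neg (sum_congr rfl fun d hd => ?_)
  rw [← mul_sum, ← (hS δ κ x y).1]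
  have hlt : d.1 < k := by
    obtain ⟨h1, h2⟩ := mem_erase.1 hd
    rw [HasAntidiagonal.mem_antidiagonal] at h2
    refine lt_of_le_of_ne (by omega) fun h3 => h1 (Prod.ext h3 ?_)
    simp only
    omega
  rw [ih d.1 hlt _ h]
  exact congrArg _ (hb.opFam_congr 0 d.1 (fun x y h => hT d.2 F x y h) h)

theorem hop_comm (hb : IsBracket br) (k k' : ℕ)
    (F : (Fin m → ℂ) → (Fin r → ℂ) → ℂ) (h : Generic br δ κ x y) :
    Hop br δ κ m r k (Hop br δ κ m r k' F) x y = Hop br δ κ m r k' (Hop br δ κ m r k F) x y :=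
  hb.hop_comm_of_dop_comm 0 k (fun i F _ _ h => hb.hop_dop_comm h k i F) k' F h

theorem dop_comm (hb : IsBracket br) (k k' : ℕ)
    (F : (Fin m → ℂ) → (Fin r → ℂ) → ℂ) (h : Generic br δ κ x y) :
    Dop br δ κ m r k (Dop br δ κ m r k' F) x y = Dop br δ κ m r k' (Dop br δ κ m r k F) x y := by
  simp only [dop_eq_hop]
  exact hb.hop_comm k k' _ (h.swap hb).neg

theorem hhat_comm (hb : IsBracket br) (k k' : ℕ)
    (F : (Fin m → ℂ) → (Fin r → ℂ) → ℂ) (h : Generic br δ κ x y) :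
    Hhat br δ κ m r k (Hhat br δ κ m r k' F) x y
      = Hhat br δ κ m r k' (Hhat br δ κ m r k F) x y := by
  simp only [hhat_eq_hop, add_sub_cancel_right, sub_add_cancel]
  exact hb.hop_comm k k' _ h.sub_add

theorem dhat_comm (hb : IsBracket br) (k k' : ℕ)
    (F : (Fin m → ℂ) → (Fin r → ℂ) → ℂ) (h : Generic br δ κ x y) :
    Dhat br δ κ m r k (Dhat br δ κ m r k' F) x y
      = Dhat br δ κ m r k' (Dhat br δ κ m r k F) x y := by
  simp only [dhat_eq_hhat]
  exact hb.hhat_comm k k' _ (h.swap hb).neg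

theorem hhat_dhat_comm (hb : IsBracket br) (k k' : ℕ)
    (F : (Fin m → ℂ) → (Fin r → ℂ) → ℂ) (h : Generic br δ κ x y) :
    Hhat br δ κ m r k (Dhat br δ κ m r k' F) x y
      = Dhat br δ κ m r k' (Hhat br δ κ m r k F) x y := by
  simp only [hhat_eq_hop, dhat_eq_dop, add_sub_cancel_right, sub_add_cancel]
  exact hb.hop_dop_comm h.sub_add k k' _

theorem hhat_dop_comm (hb : IsBracket br) (k k' : ℕ)
    (F : (Fin m → ℂ) → (Fin r → ℂ) → ℂ) (h : Generic br δ κ x y) :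
    Hhat br δ κ m r k (Dop br δ κ m r k' F) x y
      = Dop br δ κ m r k' (Hhat br δ κ m r k F) x y := by
  have key := hb.hop_dhat_comm h.sub_add k k' fun x y => F (fun i => x i + δ) (fun j => y j - κ)
  simp only [dhat_eq_dop, neg_neg, ← sub_eq_add_neg, sub_neg_eq_add, sub_add_cancel,
    add_sub_cancel_right] at key
  simpa only [hhat_eq_hop] using key

theorem hhat_hop_comm (hb : IsBracket br) (k k' : ℕ)
    (F : (Fin m → ℂ) → (Fin r → ℂ) → ℂ) (h : Generic br δ κ x y) :
    Hhat br δ κ m r k (Hop br δ κ m r k' F) x y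
      = Hop br δ κ m r k' (Hhat br δ κ m r k F) x y :=
  hb.hop_comm_of_dop_comm 1 k (fun i F _ _ h => hb.hhat_dop_comm k i F h) k' F h

theorem dhat_dop_comm (hb : IsBracket br) (k k' : ℕ)
    (F : (Fin m → ℂ) → (Fin r → ℂ) → ℂ) (h : Generic br δ κ x y) :
    Dhat br δ κ m r k (Dop br δ κ m r k' F) x y
      = Dop br δ κ m r k' (Dhat br δ κ m r k F) x y := by
  simp only [dhat_eq_hhat, dop_eq_hop]
  exact hb.hhat_hop_comm k k' _ (h.swap hb).neg

/-- The four families commute at generic points. -/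
theorem opFam_comm_of_generic (hb : IsBracket br) (f g : Fin 4) (k k' : ℕ)
    (F : (Fin m → ℂ) → (Fin r → ℂ) → ℂ) (h : Generic br δ κ x y) :
    OpFam br δ κ m r f k (OpFam br δ κ m r g k' F) x y
      = OpFam br δ κ m r g k' (OpFam br δ κ m r f k F) x y := by
  fin_cases f <;> fin_cases g
  · exact hb.hop_comm k k' F h
  · exact (hb.hhat_hop_comm k' k F h).symm
  · exact hb.hop_dop_comm h k k' F
  · exact hb.hop_dhat_comm h k k' F
  · exact hb.hhat_hop_comm k k' F h
  · exact hb.hhat_comm k k' F h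
  · exact hb.hhat_dop_comm k k' F h
  · exact hb.hhat_dhat_comm k k' F h
  · exact (hb.hop_dop_comm h k' k F).symm
  · exact (hb.hhat_dop_comm k' k F h).symm
  · exact hb.dop_comm k k' F h
  · exact (hb.dhat_dop_comm k' k F h).symm
  · exact (hb.hop_dhat_comm h k' k F).symm
  · exact (hb.hhat_dhat_comm k' k F h).symm
  · exact hb.dhat_dop_comm k k' F h
  · exact hb.dhat_comm k k' F h

end IsBracket

end

namespace IsBracket
variable {br : ℂ → ℂ} {m r : ℕ}

theorem eventually_residual_ne_zero (hb : IsBracket br) {V : Type*} [AddCommGroup V] [Module ℂ V]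
    [TopologicalSpace V] [ContinuousAdd V] [ContinuousSMul ℂ V] {u : V → ℂ} (hu : Continuous u)
    (v : V) (hv : ∀ P s, u (P + s • v) = u P + s) : ∀ᶠ P in residual V, br (u P) ≠ 0 := by
  refine residual_of_dense_open (isOpen_ne.preimage (hb.continuous.comp hu)) fun P => ?_
  have ht : Tendsto (fun s : ℂ => P + s • v) (𝓝[≠] 0) (𝓝 P) := by
    have : Continuous fun s : ℂ => P + s • v := by fun_prop
    simpa using (this.tendsto 0).mono_left nhdsWithin_le_nhds
  refine mem_closure_of_tendsto ht ?_
  filter_upwards [hb.eventually_add_ne_zero (u P)] with s hs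
  simpa [hv] using hs

theorem dense_generic (hb : IsBracket br) (m r : ℕ) :
    Dense {P : (ℂ × ℂ) × (Fin m → ℂ) × (Fin r → ℂ) | Generic br P.1.1 P.1.2 P.2.1 P.2.2} := by
  have lat : ∀ p q : ℤ, p ≠ 0 ∨ q ≠ 0 →
      ∀ᶠ P in residual ((ℂ × ℂ) × (Fin m → ℂ) × (Fin r → ℂ)), br (p * P.1.1 + q * P.1.2) ≠ 0 := by
    intro p q hpq
    by_cases hp : p = 0
    · have hq : (q : ℂ) ≠ 0 := Int.cast_ne_zero.2 (hpq.resolve_left (not_not.2 hp))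
      refine hb.eventually_residual_ne_zero (by fun_prop) ((0, (q : ℂ)⁻¹), 0) fun P s => ?_
      simp
      field_simp
      ring
    · have hp : (p : ℂ) ≠ 0 := Int.cast_ne_zero.2 hp
      refine hb.eventually_residual_ne_zero (by fun_prop) (((p : ℂ)⁻¹, 0), 0) fun P s => ?_
      simp
      field_simp
      ring
  have left : ∀ i j (p q : ℤ), (i = j → p ≠ 0 ∨ q ≠ 0) →
      ∀ᶠ P in residual ((ℂ × ℂ) × (Fin m → ℂ) × (Fin r → ℂ)),
        br (P.2.1 i - P.2.1 j + (p * P.1.1 + q * P.1.2)) ≠ 0 := by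
    intro i j p q h
    by_cases hij : i = j
    · subst hij
      simpa using lat p q (h rfl)
    · refine hb.eventually_residual_ne_zero (by fun_prop) (0, (Pi.single i 1, 0)) fun P s => ?_
      simp [Ne.symm hij]
      ring
  have right : ∀ i j (p q : ℤ), (i = j → p ≠ 0 ∨ q ≠ 0) →
      ∀ᶠ P in residual ((ℂ × ℂ) × (Fin m → ℂ) × (Fin r → ℂ)),
        br (P.2.2 i - P.2.2 j + (p * P.1.2 + q * P.1.1)) ≠ 0 := by
    intro i j p q h
    by_cases hij : i = j
    · subst hij
      simpa [add_comm] using lat q p (h rfl).symm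
    · refine hb.eventually_residual_ne_zero (by fun_prop) (0, (0, Pi.single i 1)) fun P s => ?_
      simp [Ne.symm hij]
      ring
  have cross : ∀ i j (p q : ℤ),
      ∀ᶠ P in residual ((ℂ × ℂ) × (Fin m → ℂ) × (Fin r → ℂ)),
        br (P.2.1 i - P.2.2 j + (p * P.1.1 + q * P.1.2)) ≠ 0 := by
    intro i j p q
    refine hb.eventually_residual_ne_zero (by fun_prop) (0, (Pi.single i 1, 0)) fun P s => ?_
    simp
    ring
  refine dense_of_mem_residual ?_
  simp only [← eventually_countable_forall] at lat left right cross
  filter_upwards [lat, left, right, cross] with P h1 h2 h3 h4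
  exact ⟨h2, h3, h4, h1⟩

end IsBracket

theorem latticeShift_latticeShift (c : ℂ) {m : ℕ} (a b : Fin m → ℤ) (x : Fin m → ℂ) :
    latticeShift c b (latticeShift c a x) = latticeShift c (a + b) x := by
  ext i
  simp only [latticeShift, Pi.add_apply]
  push_cast
  ring

theorem latticeShift_injective {c : ℂ} (hc : c ≠ 0) {m : ℕ} (x : Fin m → ℂ) :
    Function.Injective fun a => latticeShift c a x := by
  intro a b h
  ext i
  simpa [latticeShift, hc] using congrFun h i

namespace IsBracket
variable {br : ℂ → ℂ} {δ κ : ℂ} {m r : ℕ} {x : Fin m → ℂ} {y : Fin r → ℂ}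

theorem opFam_comm (hb : IsBracket br) (f g : Fin 4) (k k' : ℕ)
    (F : (Fin m → ℂ) → (Fin r → ℂ) → ℂ)
    (h1 : FamAdm br δ κ m r f k x y) (h2 : FamAdm br δ κ m r g k' x y)
    (h3 : ∀ q ∈ FamShifts δ κ m r g k' x y, FamAdm br δ κ m r f k q.1 q.2)
    (h4 : ∀ q ∈ FamShifts δ κ m r f k x y, FamAdm br δ κ m r g k' q.1 q.2) :
    OpFam br δ κ m r f k (OpFam br δ κ m r g k' F) x y
      = OpFam br δ κ m r g k' (OpFam br δ κ m r f k F) x y := by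
  obtain ⟨ι, S, c, a, b, hS⟩ := hb.opFam_eq_sum m r f k
  obtain ⟨ι', S', c', a', b', hS'⟩ := hb.opFam_eq_sum m r g k'
  let L : ((Fin m → ℤ) → (Fin r → ℤ) → ℂ) → (ℂ × ℂ) × (Fin m → ℂ) × (Fin r → ℂ) → ℂ := fun Φ P =>
    ∑ s ∈ S, c s P.1.1 P.1.2 P.2.1 P.2.2 * ∑ s' ∈ S', c' s' P.1.1 P.1.2
      (latticeShift P.1.1 (a s) P.2.1) (latticeShift P.1.2 (b s) P.2.2) *
        Φ (a s + a' s') (b s + b' s')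
  let R : ((Fin m → ℤ) → (Fin r → ℤ) → ℂ) → (ℂ × ℂ) × (Fin m → ℂ) × (Fin r → ℂ) → ℂ := fun Φ P =>
    ∑ s' ∈ S', c' s' P.1.1 P.1.2 P.2.1 P.2.2 * ∑ s ∈ S, c s P.1.1 P.1.2
      (latticeShift P.1.1 (a' s') P.2.1) (latticeShift P.1.2 (b' s') P.2.2) *
        Φ (a' s' + a s) (b' s' + b s)
  have hL : ∀ F P, OpFam br P.1.1 P.1.2 m r f k (OpFam br P.1.1 P.1.2 m r g k' F) P.2.1 P.2.2
      = L (fun a b => F (latticeShift P.1.1 a P.2.1) (latticeShift P.1.2 b P.2.2)) P := by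
    intro F P
    simp only [L, (hS _ _ _ _).1, (hS' _ _ _ _).1, latticeShift_latticeShift]
  have hR : ∀ F P, OpFam br P.1.1 P.1.2 m r g k' (OpFam br P.1.1 P.1.2 m r f k F) P.2.1 P.2.2
      = R (fun a b => F (latticeShift P.1.1 a P.2.1) (latticeShift P.1.2 b P.2.2)) P := by
    intro F P
    simp only [R, (hS _ _ _ _).1, (hS' _ _ _ _).1, latticeShift_latticeShift]
  set Φ := fun a b => F (latticeShift δ a x) (latticeShift κ b y) with hΦ
  have hcont : ∀ (a : Fin m → ℤ) (b : Fin r → ℤ),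
      Continuous fun P : (ℂ × ℂ) × (Fin m → ℂ) × (Fin r → ℂ) =>
        ((P.1, (latticeShift P.1.1 a P.2.1, latticeShift P.1.2 b P.2.2)) :
          (ℂ × ℂ) × (Fin m → ℂ) × (Fin r → ℂ)) := by
    intro a b
    unfold latticeShift
    fun_prop
  have cL : ContinuousAt (L Φ) ((δ, κ), (x, y)) := by
    refine tendsto_finsetSum _ fun s hs => ((hS δ κ x y).2.2 h1 s hs).mul
      (tendsto_finsetSum _ fun s' hs' => Tendsto.mul ?_ tendsto_const_nhds)
    exact ContinuousAt.comp (x := ((δ, κ), (x, y)))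
      (f := fun P : (ℂ × ℂ) × (Fin m → ℂ) × (Fin r → ℂ) =>
        ((P.1, (latticeShift P.1.1 (a s) P.2.1, latticeShift P.1.2 (b s) P.2.2)) :
          (ℂ × ℂ) × (Fin m → ℂ) × (Fin r → ℂ)))
      ((hS' δ κ _ _).2.2 (h4 _ ((hS δ κ x y).2.1 s hs)) s' hs') (hcont _ _).continuousAt
  have cR : ContinuousAt (R Φ) ((δ, κ), (x, y)) := by
    refine tendsto_finsetSum _ fun s' hs' => ((hS' δ κ x y).2.2 h2 s' hs').mul
      (tendsto_finsetSum _ fun s hs => Tendsto.mul ?_ tendsto_const_nhds)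
    exact ContinuousAt.comp (x := ((δ, κ), (x, y)))
      (f := fun P : (ℂ × ℂ) × (Fin m → ℂ) × (Fin r → ℂ) =>
        ((P.1, (latticeShift P.1.1 (a' s') P.2.1, latticeShift P.1.2 (b' s') P.2.2)) :
          (ℂ × ℂ) × (Fin m → ℂ) × (Fin r → ℂ)))
      ((hS δ κ _ _).2.2 (h3 _ ((hS' δ κ x y).2.1 s' hs')) s hs) (hcont _ _).continuousAt
  have hgen : ∀ P : (ℂ × ℂ) × (Fin m → ℂ) × (Fin r → ℂ),
      Generic br P.1.1 P.1.2 P.2.1 P.2.2 → L Φ P = R Φ P := by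
    intro P hP
    have hne : ∀ {z : ℂ}, br z ≠ 0 → z ≠ 0 := fun hz h0 => hz (by rw [h0, hb.map_zero])
    have hδ : P.1.1 ≠ 0 := hne (by simpa using hP.lattice 1 0 (by simp))
    have hκ : P.1.2 ≠ 0 := hne (by simpa using hP.lattice 0 1 (by simp))
    have hinj : Function.Injective fun ab : (Fin m → ℤ) × (Fin r → ℤ) =>
        (latticeShift P.1.1 ab.1 P.2.1, latticeShift P.1.2 ab.2 P.2.2) := fun u v huv =>
      Prod.ext (latticeShift_injective hδ _ (congrArg Prod.fst huv))
        (latticeShift_injective hκ _ (congrArg Prod.snd huv))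
    obtain ⟨G, hG⟩ : ∃ G : (Fin m → ℂ) → (Fin r → ℂ) → ℂ,
        (fun a b => G (latticeShift P.1.1 a P.2.1) (latticeShift P.1.2 b P.2.2)) = Φ := by
      refine ⟨fun x y => Function.extend (fun ab : (Fin m → ℤ) × (Fin r → ℤ) =>
        (latticeShift P.1.1 ab.1 P.2.1, latticeShift P.1.2 ab.2 P.2.2))
          (fun ab => Φ ab.1 ab.2) 0 (x, y), ?_⟩
      funext a b
      exact hinj.extend_apply _ _ (a, b)
    rw [← hG, ← hL, ← hR]
    exact hb.opFam_comm_of_generic f g k k' G hP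
  have hN : (𝓝[{P : (ℂ × ℂ) × (Fin m → ℂ) × (Fin r → ℂ) | Generic br P.1.1 P.1.2 P.2.1 P.2.2}]
      ((δ, κ), (x, y))).NeBot :=
    mem_closure_iff_nhdsWithin_neBot.1 (hb.dense_generic m r _)
  have key : L Φ ((δ, κ), (x, y)) = R Φ ((δ, κ), (x, y)) := by
    refine tendsto_nhds_unique (l := 𝓝[{P | Generic br P.1.1 P.1.2 P.2.1 P.2.2}] ((δ, κ), (x, y)))
      (cL.tendsto.mono_left nhdsWithin_le_nhds)
      ((cR.tendsto.mono_left nhdsWithin_le_nhds).congr' ?_)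
    filter_upwards [self_mem_nhdsWithin] with P hP
    exact (hgen P hP).symm
  rw [← hL F ((δ, κ), (x, y)), ← hR F ((δ, κ), (x, y))] at key
  exact key

end IsBracket

end

/-- For fixed `m` and `r`, any two of the operators
`H_{m,r}^{(k₁)}`, `Ĥ_{m,r}^{(k₂)}`, `D_{m,r}^{(k₃)}`, `D̂_{m,r}^{(k₄)}` commute
at every admissible point. -/
theorem four_families_commute
    (br : ℂ → ℂ) (hodd : ∀ z : ℂ, br (-z) = -br z)
    (hent : Differentiable ℂ br) (hnz : br ≠ 0)
    (hW : ∀ a b c d : ℂ,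
      br (a + b) * br (a - b) * br (c + d) * br (c - d)
        + br (a + d) * br (a - d) * br (b + c) * br (b - c)
        = br (a + c) * br (a - c) * br (b + d) * br (b - d))
    (δ κ : ℂ)
    (hδ : ∀ n : ℕ, 1 ≤ n → br ((n : ℂ) * δ) ≠ 0)
    (hκ : ∀ n : ℕ, 1 ≤ n → br ((n : ℂ) * κ) ≠ 0)
    (m r : ℕ) (f g : Fin 4) (k k' : ℕ)
    (F : (Fin m → ℂ) → (Fin r → ℂ) → ℂ)
    (x : Fin m → ℂ) (y : Fin r → ℂ)
    (h1 : FamAdm br δ κ m r f k x y)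
    (h2 : FamAdm br δ κ m r g k' x y)
    (h3 : ∀ q ∈ FamShifts δ κ m r g k' x y, FamAdm br δ κ m r f k q.1 q.2)
    (h4 : ∀ q ∈ FamShifts δ κ m r f k x y, FamAdm br δ κ m r g k' q.1 q.2) :
    OpFam br δ κ m r f k (fun x' y' => OpFam br δ κ m r g k' F x' y') x y
      = OpFam br δ κ m r g k' (fun x' y' => OpFam br δ κ m r f k F x' y') x y := by
  have hb : IsBracket br := ⟨hodd, hent, hnz, hW⟩
  exact hb.opFam_comm f g k k' F h1 h2 h3 h4
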